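/- arXiv:2201.08703 — 4 statements merged into one kernel-verified Lean document; each statement's English description precedes it below -/
import Mathlib

section
/- Let F ∈ ℂ[x,y,z] be a homogeneous polynomial of degree 2d (d ≥ 1) defining a smooth plane curve, i.e., the only common zero in ℂ³ of the three partial derivatives of F is the origin. Then F can be written in the form F = F₁'G₁' + F₂'G₂' where F₁', G₁', F₂', G₂' are homogeneous of degree d, F₁' defines a smooth plane curve, and F₂' and G₂' intersect transversely at d² distinct points: the set of common zeros of F₂' and G₂' in the projective plane (i.e., the set of lines through the origin in ℂ³ on which both vanish) has exactly d² elements, and at every nonzero common zero P of F₂' and G₂' the gradients of F₂' and G₂' at P are linearly independent. -/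
open MvPolynomial

/-- Over `ℂ`, a transcendental element of a finitely generated algebra is detected by a derivation
of some field of values. -/
theorem isAlgebraic_of_forall_derivation_eq_zero {B : Type} [CommRing B] [Algebra ℂ B]
    [Algebra.FiniteType ℂ B] (b : B)
    (h : ∀ (L : Type) [Field L] [Algebra ℂ L] (φ : B →ₐ[ℂ] L) (δ : Derivation ℂ L L),
      δ (φ b) = 0) : IsAlgebraic ℂ b := by
  by_contra hb
  let : Algebra (Polynomial ℂ) B := (Polynomial.aeval b).toAlgebra
  have hmap : ∀ p : Polynomial ℂ, algebraMap (Polynomial ℂ) B p = Polynomial.aeval b p :=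
    fun _ => rfl
  have : IsScalarTower ℂ (Polynomial ℂ) B := .of_algebraMap_eq fun x => by
    rw [hmap]; simp
  have hinj : Function.Injective (algebraMap (Polynomial ℂ) B) :=
    transcendental_iff_injective.mp hb
  have : Algebra.FiniteType (Polynomial ℂ) B := .of_restrictScalars_finiteType ℂ _ _
  let K := FractionRing (Polynomial ℂ)
  have : Module.Flat (Polynomial ℂ) K := IsLocalization.flat K (nonZeroDivisors (Polynomial ℂ))
  have hinj' : Function.Injective
      (Algebra.TensorProduct.includeLeft : K →ₐ[Polynomial ℂ] TensorProduct (Polynomial ℂ) K B) :=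
    Algebra.TensorProduct.includeLeft_injective hinj
  have : Nontrivial (TensorProduct (Polynomial ℂ) K B) := hinj'.nontrivial
  obtain ⟨m, hm⟩ := Ideal.exists_maximal (TensorProduct (Polynomial ℂ) K B)
  let L := TensorProduct (Polynomial ℂ) K B ⧸ m
  let : Field L := Ideal.Quotient.field m
  have : Algebra.FiniteType K L := inferInstance
  have : Module.Finite K L := finite_of_finite_type_of_isJacobsonRing K L
  have : CharZero K := inferInstance
  have : Algebra.IsSeparable K L := inferInstance
  have : Algebra.FormallyEtale K L := Algebra.FormallyEtale.of_isSeparable _ L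
  have : Algebra.FormallyEtale (Polynomial ℂ) K :=
    Algebra.FormallyEtale.of_isLocalization (nonZeroDivisors (Polynomial ℂ))
  have : Algebra.FormallyEtale (Polynomial ℂ) L := .comp _ K _
  let e := (KaehlerDifferential.tensorKaehlerEquivOfFormallyEtale ℂ (Polynomial ℂ) L).symm
  let f : TensorProduct (Polynomial ℂ) L Ω[Polynomial ℂ⁄ℂ] →ₗ[L] L :=
    (((Algebra.linearMap (Polynomial ℂ) L).comp
      (KaehlerDifferential.polynomialEquiv ℂ).toLinearMap)).liftBaseChange L
  let δ : Derivation ℂ L L := (f.comp e.toLinearMap).compDer (KaehlerDifferential.D ℂ L)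
  let φ : B →ₐ[ℂ] L := ((Ideal.Quotient.mkₐ (Polynomial ℂ) m).comp
    Algebra.TensorProduct.includeRight).restrictScalars ℂ
  have h1 := h L φ δ
  have h2 : φ b = algebraMap (Polynomial ℂ) L Polynomial.X := by
    have : b = algebraMap (Polynomial ℂ) B Polynomial.X := by rw [hmap]; simp
    rw [this]
    exact AlgHom.commutes ((Ideal.Quotient.mkₐ (Polynomial ℂ) m).comp
      Algebra.TensorProduct.includeRight) _
  have h3 : δ (φ b) = 1 := by
    rw [h2]
    change f (e (KaehlerDifferential.D ℂ L _)) = 1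
    rw [KaehlerDifferential.tensorKaehlerEquivOfFormallyEtale_symm_D_algebraMap]
    simp [f]
  rw [h3] at h1
  exact one_ne_zero h1

theorem Derivation.apply_aeval_mvPolynomial {σ L : Type*} [Fintype σ] [CommRing L] [Algebra ℂ L]
    (δ : Derivation ℂ L L) (v : σ → L) (p : MvPolynomial σ ℂ) :
    δ (aeval v p) = ∑ i, aeval v (pderiv i p) * δ (v i) := by
  classical
  induction p using MvPolynomial.induction_on with
  | C a => simp
  | add p q hp hq => simp [hp, hq, add_mul, Finset.sum_add_distrib]
  | mul_X p i hp =>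
    simp [hp, pderiv_X, add_mul, Finset.sum_add_distrib, Finset.mul_sum, Pi.single_apply]
    congr 1
    · rw [Finset.sum_eq_single i]
      · simp
      · intro j _ hj; simp [hj.symm]
      · simp
    · exact Finset.sum_congr rfl fun j _ => by ring

/-- Generic smoothness: if every derivation kills `ℓ` along the locally closed
set `{e = 0 for e ∈ E, q ≠ 0}`, then `ℓ` takes only finitely many values on it. -/
theorem finite_values_of_forall_derivation_eq_zero {σ : Type} [Fintype σ]
    (E : Set (MvPolynomial σ ℂ)) (q l : MvPolynomial σ ℂ)
    (h : ∀ (L : Type) [Field L] [Algebra ℂ L] (δ : Derivation ℂ L L) (v : σ → L),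
      (∀ e ∈ E, aeval v e = 0) → aeval v q ≠ 0 → δ (aeval v l) = 0) :
    {z : ℂ | ∃ v : σ → ℂ, (∀ e ∈ E, eval v e = 0) ∧ eval v q ≠ 0 ∧ eval v l = z}.Finite := by
  let R := MvPolynomial (Option σ) ℂ
  let ι : MvPolynomial σ ℂ →ₐ[ℂ] R := rename some
  let I : Ideal R := Ideal.span (ι '' E ∪ {X none * ι q - 1})
  let b : R ⧸ I := Ideal.Quotient.mk I (ι l)
  have halg : IsAlgebraic ℂ b := by
    refine isAlgebraic_of_forall_derivation_eq_zero b ?_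
    intro L _ _ φ δ
    let w : Option σ → L := fun i => φ (Ideal.Quotient.mk I (X i))
    have hw : ∀ p : R, φ (Ideal.Quotient.mk I p) = aeval w p := by
      intro p
      have : (φ.comp (Ideal.Quotient.mkₐ ℂ I)) = aeval w := by
        apply MvPolynomial.algHom_ext
        intro i
        simp [w]
      exact congrArg (fun f => f p) this
    have hw' : ∀ p, φ (Ideal.Quotient.mk I (ι p)) = aeval (fun i => w (some i)) p := by
      intro p
      rw [hw, aeval_rename]
      rfl
    have hb : φ b = aeval (fun i => w (some i)) l := hw' l
    rw [hb]
    apply h L δ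
    · intro e he
      rw [← hw', Ideal.Quotient.eq_zero_iff_mem.mpr, map_zero]
      exact Ideal.subset_span (Or.inl ⟨e, he, rfl⟩)
    · intro h0
      have : φ (Ideal.Quotient.mk I (X none * ι q - 1)) = 0 := by
        rw [Ideal.Quotient.eq_zero_iff_mem.mpr, map_zero]
        exact Ideal.subset_span (Or.inr rfl)
      rw [map_sub, map_mul, map_sub, map_mul, hw', h0] at this
      simp at this
  obtain ⟨g, hg, hgb⟩ := halg
  refine (g.rootSet_finite ℂ).subset ?_
  rintro z ⟨v, hE, hq, rfl⟩
  rw [Polynomial.mem_rootSet]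
  refine ⟨hg, ?_⟩
  let ev : R →ₐ[ℂ] ℂ := aeval (fun i => i.elim (eval v q)⁻¹ v)
  have hev : ∀ p, ev (ι p) = eval v p := by
    intro p
    simp only [ev, ι]
    rw [aeval_rename]
    rfl
  have hI : I ≤ RingHom.ker ev.toRingHom := by
    refine Ideal.span_le.mpr ?_
    rintro _ (⟨e, he, rfl⟩ | rfl)
    · change ev _ = 0
      rw [hev, hE e he]
    · change ev _ = 0
      rw [map_sub, map_mul, hev]
      have : ev (X none) = (eval v q)⁻¹ := aeval_X _ _
      rw [this, inv_mul_cancel₀ hq, map_one, sub_self]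
  let ψ : R ⧸ I →ₐ[ℂ] ℂ := Ideal.Quotient.liftₐ I ev hI
  have : ψ (Polynomial.aeval b g) = 0 := by rw [hgb, map_zero]
  rw [← Polynomial.aeval_algHom_apply] at this
  have h2 : ψ b = eval v l := by rw [← hev]; rfl
  rw [h2] at this
  exact this

namespace MvPolynomial

theorem finrank_homogeneousSubmodule_fin_three (n : ℕ) :
    Module.finrank ℂ (homogeneousSubmodule (Fin 3) ℂ n) = (n + 2).choose 2 := by
  classical
  rw [homogeneousSubmodule_eq_finsupp_supported,
    (AddMonoidAlgebra.supportedEquivFinsupp (R := ℂ) (S := ℂ)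
      {d : Fin 3 →₀ ℕ | d.degree = n}).finrank_eq]
  have e : {d : Fin 3 →₀ ℕ | d.degree = n} ≃ Sym (Fin 3) n :=
    (Equiv.subtypeEquivRight fun d => by
      rw [Set.mem_ofPred_eq, Finsupp.degree_apply, Finsupp.sum]; rfl).trans
      (Sym.equivNatSum (Fin 3) n).symm
  have : Fintype {d : Fin 3 →₀ ℕ | d.degree = n} := Fintype.ofEquiv _ e.symm
  rw [Module.finrank_finsupp_self, Fintype.card_congr e, Sym.card_sym_eq_choose, Fintype.card_fin,
    show 3 + n - 1 = n + 2 by omega, ← Nat.choose_symm_add]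

instance finite_homogeneousSubmodule (n : ℕ) :
    Module.Finite ℂ (homogeneousSubmodule (Fin 3) ℂ n) :=
  Module.Finite.iff_fg.mpr (homogeneousSubmodule_fg _ _ n)

/-- Projective Nullstellensatz. -/
theorem exists_forall_isHomogeneous_mem {J : Ideal (MvPolynomial (Fin 3) ℂ)}
    (hJ : ∀ P : Fin 3 → ℂ, (∀ p ∈ J, eval P p = 0) → P = 0) :
    ∃ N, ∀ n, N ≤ n → ∀ G : MvPolynomial (Fin 3) ℂ, G.IsHomogeneous n → G ∈ J := by
  have hle : Ideal.span (Set.range (X : Fin 3 → MvPolynomial (Fin 3) ℂ)) ≤ J.radical := by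
    rw [Ideal.span_le]
    rintro _ ⟨i, rfl⟩
    rw [← vanishingIdeal_zeroLocus_eq_radical (K := ℂ)]
    intro P hP
    have : P = 0 := hJ P fun p hp => by simpa [aeval_eq_eval] using hP p hp
    simp [this]
  obtain ⟨N, hN⟩ := Ideal.exists_pow_le_of_le_radical_of_fg hle
    ((isNoetherianRing_iff_ideal_fg _).mp inferInstance _)
  refine ⟨N, fun n hn G hG => hN (Ideal.pow_le_pow_right hn ?_)⟩
  rw [Ideal.mem_span_pow_iff_exists_isHomogeneous]
  refine ⟨map C G, hG.map _, ?_⟩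
  rw [eval_map, eval₂_eta]

theorem homogeneousComponent_mul_of_isHomogeneous {a : ℕ} {A : MvPolynomial (Fin 3) ℂ}
    (hA : A.IsHomogeneous a) (m : ℕ) (u : MvPolynomial (Fin 3) ℂ) :
    homogeneousComponent (m + a) (u * A) = homogeneousComponent m u * A := by
  conv_lhs => rw [← sum_homogeneousComponent u, Finset.sum_mul, map_sum]
  have h : ∀ i, homogeneousComponent (m + a) (homogeneousComponent i u * A) =
      if m = i then homogeneousComponent m u * A else 0 := by
    intro i
    rw [homogeneousComponent_of_mem ((homogeneousComponent_isHomogeneous i u).mul hA)]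
    by_cases him : m = i
    · subst him; simp
    · simp [him]
  simp_rw [h]
  rw [Finset.sum_ite_eq]
  split_ifs with hm
  · rfl
  · rw [homogeneousComponent_eq_zero, zero_mul]
    simpa [Nat.lt_succ_iff] using hm

theorem exists_isHomogeneous_of_mem_span_pair {a b m : ℕ} {A B G : MvPolynomial (Fin 3) ℂ}
    (hA : A.IsHomogeneous a) (hB : B.IsHomogeneous b) (hG : G.IsHomogeneous (a + b + m))
    (h : G ∈ Ideal.span {A, B}) :
    ∃ u v : MvPolynomial (Fin 3) ℂ, u.IsHomogeneous (b + m) ∧ v.IsHomogeneous (a + m) ∧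
      G = u * A + v * B := by
  obtain ⟨u, v, rfl⟩ := Ideal.mem_span_pair.mp h
  refine ⟨homogeneousComponent (b + m) u, homogeneousComponent (a + m) v,
    homogeneousComponent_isHomogeneous _ _, homogeneousComponent_isHomogeneous _ _, ?_⟩
  rw [← homogeneousComponent_mul_of_isHomogeneous hA, ← homogeneousComponent_mul_of_isHomogeneous hB,
    show b + m + a = a + b + m by ring, show a + m + b = a + b + m by ring, ← map_add,
    homogeneousComponent_eq_self hG]

/-- Multiplication by a form, as a linear map between graded pieces. -/
noncomputable def mulForm {a m n : ℕ} {A : MvPolynomial (Fin 3) ℂ} (hA : A.IsHomogeneous a)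
    (h : m + a = n) : homogeneousSubmodule (Fin 3) ℂ m →ₗ[ℂ] homogeneousSubmodule (Fin 3) ℂ n :=
  (LinearMap.mulRight ℂ A).restrict fun p hp => by
    rw [mem_homogeneousSubmodule] at *
    rw [← h]
    exact IsHomogeneous.mul hp hA

@[simp]
theorem coe_mulForm {a m n : ℕ} {A : MvPolynomial (Fin 3) ℂ} (hA : A.IsHomogeneous a)
    (h : m + a = n) (p : homogeneousSubmodule (Fin 3) ℂ m) :
    (mulForm hA h p : MvPolynomial (Fin 3) ℂ) = p * A := rfl

/-- The degree `a + b + m` part of the ideal generated by forms `A` and `B`. -/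
noncomputable def pairMap {a b : ℕ} (m : ℕ) {A B : MvPolynomial (Fin 3) ℂ}
    (hA : A.IsHomogeneous a) (hB : B.IsHomogeneous b) :
    homogeneousSubmodule (Fin 3) ℂ (b + m) × homogeneousSubmodule (Fin 3) ℂ (a + m) →ₗ[ℂ]
      homogeneousSubmodule (Fin 3) ℂ (a + b + m) :=
  (mulForm hA (by ring)).coprod (mulForm hB (by ring))

/-- The Koszul syzygies of a pair of forms. -/
noncomputable def syzygyMap {a b : ℕ} (m : ℕ) {A B : MvPolynomial (Fin 3) ℂ}
    (hA : A.IsHomogeneous a) (hB : B.IsHomogeneous b) :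
    homogeneousSubmodule (Fin 3) ℂ m →ₗ[ℂ]
      homogeneousSubmodule (Fin 3) ℂ (b + m) × homogeneousSubmodule (Fin 3) ℂ (a + m) :=
  (mulForm hB (by ring)).prod (-(mulForm hA (by ring)))

theorem choose_two_identity (a b m : ℕ) :
    (a + b + m + 2).choose 2 + (m + 2).choose 2 =
      (b + m + 2).choose 2 + (a + m + 2).choose 2 + a * b := by
  have h : ∀ n : ℕ, ((n + 2).choose 2 : ℚ) = (n + 2) * (n + 1) / 2 := fun n => by
    rw [Nat.cast_choose_two]; push_cast; ring
  have : (((a + b + m + 2).choose 2 + (m + 2).choose 2 : ℕ) : ℚ) =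
      ((b + m + 2).choose 2 + (a + m + 2).choose 2 + a * b : ℕ) := by
    push_cast
    rw [h, h, h, h]; push_cast; ring
  exact_mod_cast this

theorem range_syzygyMap_le {a b : ℕ} (m : ℕ) {A B : MvPolynomial (Fin 3) ℂ}
    (hA : A.IsHomogeneous a) (hB : B.IsHomogeneous b) :
    LinearMap.range (syzygyMap m hA hB) ≤ LinearMap.ker (pairMap m hA hB) := by
  rintro _ ⟨w, rfl⟩
  rw [LinearMap.mem_ker]
  ext1
  simp only [pairMap, syzygyMap, LinearMap.coprod_apply, LinearMap.prod_apply, Function.prod,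
    LinearMap.neg_apply, map_neg, Submodule.coe_add, Submodule.coe_neg, coe_mulForm,
    Submodule.coe_zero]
  ring

theorem syzygyMap_injective {a b : ℕ} (m : ℕ) {A B : MvPolynomial (Fin 3) ℂ}
    (hA : A.IsHomogeneous a) (hB : B.IsHomogeneous b) (hA0 : A ≠ 0) :
    Function.Injective (syzygyMap m hA hB) := by
  rw [injective_iff_map_eq_zero]
  intro w hw
  have h := congrArg (fun p => (p.2 : MvPolynomial (Fin 3) ℂ)) hw
  simp only [syzygyMap, LinearMap.prod_apply, Function.prod, LinearMap.neg_apply, Submodule.coe_neg,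
    coe_mulForm, Prod.snd_zero, Submodule.coe_zero, neg_eq_zero, mul_eq_zero, hA0, or_false] at h
  exact Subtype.ext h

theorem finrank_range_pairMap_add_le {a b : ℕ} (m : ℕ) {A B : MvPolynomial (Fin 3) ℂ}
    (hA : A.IsHomogeneous a) (hB : B.IsHomogeneous b) (hA0 : A ≠ 0) :
    Module.finrank ℂ (LinearMap.range (pairMap m hA hB)) + a * b ≤ (a + b + m + 2).choose 2 := by
  have h1 := (pairMap m hA hB).finrank_range_add_finrank_ker
  have h2 := LinearMap.finrank_range_of_inj (syzygyMap_injective m hA hB hA0)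
  have h3 := Submodule.finrank_mono (range_syzygyMap_le m hA hB)
  rw [Module.finrank_prod] at h1
  simp only [finrank_homogeneousSubmodule_fin_three] at h1 h2
  have := choose_two_identity a b m
  omega

theorem finrank_range_pairMap_add_eq {a b : ℕ} (m : ℕ) {A B : MvPolynomial (Fin 3) ℂ}
    (hA : A.IsHomogeneous a) (hB : B.IsHomogeneous b) (hA0 : A ≠ 0) (h : IsRelPrime A B) :
    Module.finrank ℂ (LinearMap.range (pairMap m hA hB)) + a * b = (a + b + m + 2).choose 2 := by
  have h1 := (pairMap m hA hB).finrank_range_add_finrank_ker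
  have h2 := LinearMap.finrank_range_of_inj (syzygyMap_injective m hA hB hA0)
  have h3 : LinearMap.range (syzygyMap m hA hB) = LinearMap.ker (pairMap m hA hB) := by
    refine le_antisymm (range_syzygyMap_le m hA hB) ?_
    rintro ⟨u, v⟩ huv
    have huv' : (u : MvPolynomial (Fin 3) ℂ) * A + v * B = 0 :=
      congrArg Subtype.val (LinearMap.mem_ker.mp huv)
    obtain ⟨w, hw⟩ : A ∣ v := h.dvd_of_dvd_mul_right ⟨-u, by linear_combination huv'⟩
    have hv : homogeneousComponent m w * A = v := by
      rw [← homogeneousComponent_mul_of_isHomogeneous hA, mul_comm w, ← hw,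
        homogeneousComponent_eq_self]
      have := v.2
      rw [mem_homogeneousSubmodule] at this
      rwa [add_comm m]
    have hu : (u : MvPolynomial (Fin 3) ℂ) = -(homogeneousComponent m w * B) := by
      apply mul_right_cancel₀ hA0
      linear_combination huv' + B * hv
    refine ⟨⟨-homogeneousComponent m w, (homogeneousComponent_isHomogeneous m w).neg⟩, ?_⟩
    ext1
    · ext1
      simp [syzygyMap, hu]
    · ext1
      simp [syzygyMap, hv]
  rw [Module.finrank_prod] at h1
  rw [h3] at h2
  simp only [finrank_homogeneousSubmodule_fin_three] at h1 h2
  have := choose_two_identity a b m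
  omega

/-- Two plane curves of positive degree meet. -/
theorem exists_common_zero {a b : ℕ} {A B : MvPolynomial (Fin 3) ℂ}
    (hA : A.IsHomogeneous a) (hB : B.IsHomogeneous b) (ha : 1 ≤ a) (hb : 1 ≤ b) :
    ∃ P : Fin 3 → ℂ, P ≠ 0 ∧ eval P A = 0 ∧ eval P B = 0 := by
  by_contra! hno
  have hJ : ∀ P : Fin 3 → ℂ, (∀ p ∈ Ideal.span {A, B}, eval P p = 0) → P = 0 := by
    intro P hP
    by_contra hP0
    exact hno P hP0 (hP A (Ideal.subset_span (by simp))) (hP B (Ideal.subset_span (by simp)))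
  obtain ⟨N, hN⟩ := exists_forall_isHomogeneous_mem hJ
  have htop : LinearMap.range (pairMap N hA hB) = ⊤ := by
    rw [eq_top_iff]
    rintro ⟨G, hG⟩ -
    obtain ⟨u, v, hu, hv, huv⟩ := exists_isHomogeneous_of_mem_span_pair hA hB hG
      (hN (a + b + N) (by omega) G hG)
    exact ⟨(⟨u, hu⟩, ⟨v, hv⟩), Subtype.ext huv.symm⟩
  have key : ∀ h0 : (Module.finrank ℂ (LinearMap.range (pairMap N hA hB)) + a * b ≤
      (a + b + N + 2).choose 2), False := by
    intro h0
    rw [htop, finrank_top, finrank_homogeneousSubmodule_fin_three] at h0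
    have : 1 ≤ a * b := Nat.mul_pos ha hb
    omega
  by_cases hA0 : A = 0
  · by_cases hB0 : B = 0
    · exact hno (fun _ => 1) (fun h => one_ne_zero (congrFun h 0)) (by simp [hA0]) (by simp [hB0])
    · have htop' : LinearMap.range (pairMap N hB hA) = ⊤ := by
        rw [eq_top_iff]
        rintro ⟨G, hG⟩ -
        obtain ⟨u, v, hu, hv, huv⟩ := exists_isHomogeneous_of_mem_span_pair hB hA hG
          (by rw [Set.pair_comm]; exact hN _ (by omega) G hG)
        exact ⟨(⟨u, hu⟩, ⟨v, hv⟩), Subtype.ext huv.symm⟩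
      have h0 := finrank_range_pairMap_add_le N hB hA hB0
      rw [htop', finrank_top, finrank_homogeneousSubmodule_fin_three] at h0
      have : 1 ≤ b * a := Nat.mul_pos hb ha
      omega
  · exact key (finrank_range_pairMap_add_le N hA hB hA0)

theorem IsHomogeneous.aeval_mul {R : Type*} [CommRing R] [Algebra ℂ R] {n : ℕ}
    {G : MvPolynomial (Fin 3) ℂ} (hG : G.IsHomogeneous n) (c : R) (x : Fin 3 → R) :
    MvPolynomial.aeval (fun i => c * x i) G = c ^ n * MvPolynomial.aeval x G := by
  rw [aeval_def, aeval_def, eval₂_eq, eval₂_eq, Finset.mul_sum]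
  refine Finset.sum_congr rfl fun e he => ?_
  have h : e.degree = n := by
    rw [← hG (mem_support_iff.mp he), Finsupp.weight_apply, Finsupp.degree_apply]
    simp [Finsupp.sum]
  rw [← h, Finsupp.degree_apply, ← Finset.prod_pow_eq_pow_sum]
  simp_rw [mul_pow, Finset.prod_mul_distrib]
  ring

theorem IsHomogeneous.eval_smul {n : ℕ} {G : MvPolynomial (Fin 3) ℂ} (hG : G.IsHomogeneous n)
    (c : ℂ) (P : Fin 3 → ℂ) : eval (c • P) G = c ^ n * eval P G := by
  have := hG.aeval_mul c P
  rwa [aeval_eq_eval] at this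

/-- The homomorphism sending a form `G` of degree `n` to `G T ^ n`. -/
noncomputable def gradingHom :
    MvPolynomial (Fin 3) ℂ →ₐ[ℂ] Polynomial (MvPolynomial (Fin 3) ℂ) :=
  MvPolynomial.aeval fun i => Polynomial.X * Polynomial.C (X i)

theorem gradingHom_of_isHomogeneous {k : ℕ} {G : MvPolynomial (Fin 3) ℂ}
    (hG : G.IsHomogeneous k) : gradingHom G = Polynomial.C G * Polynomial.X ^ k := by
  have hC : (MvPolynomial.aeval fun i => Polynomial.C (X i : MvPolynomial (Fin 3) ℂ)) =
      (Algebra.ofId (MvPolynomial (Fin 3) ℂ) (Polynomial (MvPolynomial (Fin 3) ℂ))).restrictScalars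
        ℂ := by
    ext i : 1
    simp [Algebra.ofId_apply]
  rw [gradingHom, hG.aeval_mul, hC, mul_comm]
  rfl

theorem coeff_gradingHom (k : ℕ) (G : MvPolynomial (Fin 3) ℂ) :
    (gradingHom G).coeff k = homogeneousComponent k G := by
  conv_lhs => rw [← sum_homogeneousComponent G]
  rw [map_sum, Polynomial.finsetSum_coeff]
  simp_rw [gradingHom_of_isHomogeneous (homogeneousComponent_isHomogeneous _ G),
    Polynomial.coeff_C_mul_X_pow]
  rw [Finset.sum_ite_eq]
  split_ifs with hm
  · rfl
  · rw [homogeneousComponent_eq_zero]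
    simpa [Nat.lt_succ_iff] using hm

theorem gradingHom_ne_zero {G : MvPolynomial (Fin 3) ℂ} (h : G ≠ 0) : gradingHom G ≠ 0 := by
  contrapose! h
  rw [← sum_homogeneousComponent G]
  exact Finset.sum_eq_zero fun i _ => by rw [← coeff_gradingHom, h, Polynomial.coeff_zero]

/-- A divisor of a nonzero form is a form. -/
theorem IsHomogeneous.exists_of_mul {n : ℕ} {p q : MvPolynomial (Fin 3) ℂ}
    (h : (p * q).IsHomogeneous n) (h0 : p * q ≠ 0) : ∃ k, p.IsHomogeneous k := by
  have hp := gradingHom_ne_zero (left_ne_zero_of_mul h0)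
  have hq := gradingHom_ne_zero (right_ne_zero_of_mul h0)
  have hmul : gradingHom p * gradingHom q = Polynomial.C (p * q) * Polynomial.X ^ n := by
    rw [← map_mul, gradingHom_of_isHomogeneous h]
  have h1 := Polynomial.natDegree_mul hp hq
  have h2 := Polynomial.natTrailingDegree_mul hp hq
  rw [hmul, Polynomial.natDegree_C_mul_X_pow _ _ h0] at h1
  rw [hmul, Polynomial.C_mul_X_pow_eq_monomial, Polynomial.natTrailingDegree_monomial h0] at h2
  have h3 := (gradingHom p).natTrailingDegree_le_natDegree
  have h4 := (gradingHom q).natTrailingDegree_le_natDegree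
  refine ⟨(gradingHom p).natDegree, ?_⟩
  have : p = homogeneousComponent (gradingHom p).natDegree p := by
    conv_lhs => rw [← sum_homogeneousComponent p]
    rw [Finset.sum_eq_single (gradingHom p).natDegree]
    · intro j _ hj
      rw [← coeff_gradingHom]
      rcases lt_or_gt_of_ne hj with hj | hj
      · exact Polynomial.coeff_eq_zero_of_lt_natTrailingDegree (by omega)
      · exact Polynomial.coeff_eq_zero_of_natDegree_lt hj
    · intro hj
      rw [homogeneousComponent_eq_zero]
      simpa [Nat.lt_succ_iff] using hj
  have h5 := homogeneousComponent_isHomogeneous (gradingHom p).natDegree p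
  rwa [← this] at h5

theorem IsHomogeneous.exists_of_dvd {n : ℕ} {p q : MvPolynomial (Fin 3) ℂ}
    (h : q.IsHomogeneous n) (h0 : q ≠ 0) (hpq : p ∣ q) :
    ∃ k m r, k + m = n ∧ p.IsHomogeneous k ∧ IsHomogeneous r m ∧ q = p * r := by
  obtain ⟨r, rfl⟩ := hpq
  obtain ⟨k, hk⟩ := h.exists_of_mul h0
  obtain ⟨m, hm⟩ := (mul_comm p r ▸ h).exists_of_mul (mul_comm p r ▸ h0)
  exact ⟨k, m, r, (hk.mul hm).inj_right h h0, hk, hm, rfl⟩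

theorem IsHomogeneous.isUnit_of_zero {p : MvPolynomial (Fin 3) ℂ} (h : p.IsHomogeneous 0)
    (h0 : p ≠ 0) : IsUnit p := by
  have := h.totalDegree h0
  rw [totalDegree_eq_zero_iff_eq_C] at this
  rw [this]
  refine IsUnit.map C (IsUnit.mk0 _ fun h => h0 ?_)
  rw [this, h, map_zero]

/-- The linear form attached to a functional. -/
noncomputable def linearForm (f : Module.Dual ℂ (Fin 3 → ℂ)) : MvPolynomial (Fin 3) ℂ :=
  ∑ i, C (f (Pi.single i 1)) * X i

theorem isHomogeneous_linearForm (f : Module.Dual ℂ (Fin 3 → ℂ)) :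
    (linearForm f).IsHomogeneous 1 :=
  IsHomogeneous.sum _ _ _ fun i _ => by
    simpa using (isHomogeneous_C (Fin 3) (f (Pi.single i 1))).mul (isHomogeneous_X ℂ i)

theorem eval_linearForm (f : Module.Dual ℂ (Fin 3 → ℂ)) (P : Fin 3 → ℂ) :
    eval P (linearForm f) = f P := by
  conv_rhs => rw [← LinearMap.sum_single_apply (fun _ => ℂ) P, map_sum]
  simp only [linearForm, map_sum, map_mul, eval_C, eval_X]
  refine Finset.sum_congr rfl fun i _ => ?_
  have : Pi.single i (P i) = P i • (Pi.single i 1 : Fin 3 → ℂ) := by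
    rw [← Pi.single_smul]; simp
  rw [this, map_smul, smul_eq_mul, mul_comm]

/-- Evaluation of forms of degree `n` at a family of points. -/
noncomputable def evalForms {ι : Type*} (n : ℕ) (v : ι → Fin 3 → ℂ) :
    homogeneousSubmodule (Fin 3) ℂ n →ₗ[ℂ] ι → ℂ :=
  (LinearMap.pi fun i => (MvPolynomial.aeval (v i) : _ →ₐ[ℂ] ℂ).toLinearMap) ∘ₗ
    Submodule.subtype _

theorem evalForms_apply {ι : Type*} (n : ℕ) (v : ι → Fin 3 → ℂ)
    (G : homogeneousSubmodule (Fin 3) ℂ n) (i : ι) :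
    evalForms n v G i = eval (v i) (G : MvPolynomial (Fin 3) ℂ) := by
  rw [← aeval_eq_eval]; rfl

theorem evalForms_surjective {ι : Type*} [Fintype ι] {v : ι → Fin 3 → ℂ} (hv : ∀ i, v i ≠ 0)
    (hvv : ∀ i j, i ≠ j → v i ∉ Submodule.span ℂ {v j}) {n : ℕ} (hn : Fintype.card ι ≤ n) :
    Function.Surjective (evalForms n v) := by
  classical
  have key : ∀ i, ∃ G : homogeneousSubmodule (Fin 3) ℂ n, evalForms n v G = Pi.single i 1 := by
    intro i
    obtain ⟨f, hf⟩ := Module.exists_dual_forall_apply_ne_zero (K := ℂ) (fun _ : Unit => v i)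
      fun _ => hv i
    have : ∀ j, ∃ g : Module.Dual ℂ (Fin 3 → ℂ), g (v i) ≠ 0 ∧ (j ≠ i → g (v j) = 0) := by
      intro j
      by_cases hj : j = i
      · exact ⟨f, hf (), fun h => (h hj).elim⟩
      · obtain ⟨g, hg, hle⟩ := Submodule.exists_le_ker_of_notMem (hvv i j (Ne.symm hj))
        exact ⟨g, hg, fun _ => hle (Submodule.mem_span_singleton_self _)⟩
    choose g hg hg' using this
    let G : MvPolynomial (Fin 3) ℂ :=
      (∏ j, linearForm (g j)) * linearForm f ^ (n - Fintype.card ι)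
    have hG : G.IsHomogeneous n := by
      have h1 := IsHomogeneous.prod Finset.univ (fun j => linearForm (g j)) (fun _ => 1)
        fun j _ => isHomogeneous_linearForm _
      have h2 := h1.mul ((isHomogeneous_linearForm f).pow (n - Fintype.card ι))
      convert h2 using 1
      simp; omega
    have hGi : eval (v i) G ≠ 0 := by
      simp only [G, map_mul, map_prod, map_pow, eval_linearForm]
      exact mul_ne_zero (Finset.prod_ne_zero_iff.mpr fun j _ => hg j) (pow_ne_zero _ (hf ()))
    refine ⟨(eval (v i) G)⁻¹ • ⟨G, hG⟩, ?_⟩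
    ext j
    rw [map_smul, Pi.smul_apply, evalForms_apply]
    by_cases hj : j = i
    · subst hj
      simpa using inv_mul_cancel₀ hGi
    · rw [Pi.single_eq_of_ne hj]
      have : eval (v j) G = 0 := by
        simp only [G, map_mul, map_prod, map_pow, eval_linearForm]
        rw [Finset.prod_eq_zero (Finset.mem_univ j) (hg' j hj), zero_mul]
      simp [this]
  intro w
  choose G hG using key
  refine ⟨∑ i, w i • G i, ?_⟩
  rw [map_sum]
  simp_rw [map_smul, hG]
  ext j
  simp [Finset.sum_apply, Pi.single_apply]

/-- The lines of common zeros of two forms. -/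
def commonZeros (A B : MvPolynomial (Fin 3) ℂ) : Set (Submodule ℂ (Fin 3 → ℂ)) :=
  {L | ∃ v : Fin 3 → ℂ, v ≠ 0 ∧ L = Submodule.span ℂ {v} ∧ eval v A = 0 ∧ eval v B = 0}

theorem range_pairMap_le_ker_evalForms {ι : Type*} {a b m : ℕ} {A B : MvPolynomial (Fin 3) ℂ}
    (hA : A.IsHomogeneous a) (hB : B.IsHomogeneous b) {v : ι → Fin 3 → ℂ}
    (hvA : ∀ i, eval (v i) A = 0) (hvB : ∀ i, eval (v i) B = 0) :
    LinearMap.range (pairMap m hA hB) ≤ LinearMap.ker (evalForms (a + b + m) v) := by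
  rintro _ ⟨⟨p, q⟩, rfl⟩
  rw [LinearMap.mem_ker]
  ext i
  rw [evalForms_apply]
  simp [pairMap, hvA, hvB]

theorem card_le_of_subset_commonZeros {a b : ℕ} {A B : MvPolynomial (Fin 3) ℂ}
    (hA : A.IsHomogeneous a) (hB : B.IsHomogeneous b) (hA0 : A ≠ 0) (h : IsRelPrime A B)
    (s : Finset (Submodule ℂ (Fin 3 → ℂ))) (hs : (s : Set _) ⊆ commonZeros A B) :
    s.card ≤ a * b := by
  choose v hv0 hvL hvA hvB using fun L : s => hs L.2
  have hvv : ∀ i j, i ≠ j → v i ∉ Submodule.span ℂ {v j} := by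
    intro i j hij hmem
    refine hij (Subtype.ext ?_)
    rw [hvL, hvL]
    obtain ⟨c, hc⟩ := Submodule.mem_span_singleton.mp hmem
    rw [← hc]
    refine Submodule.span_singleton_smul_eq (IsUnit.mk0 c ?_) _
    rintro rfl
    exact hv0 i (by rw [← hc, zero_smul])
  have hsurj := evalForms_surjective hv0 hvv (n := a + b + Fintype.card s) (by omega)
  have h1 := LinearMap.finrank_range_add_finrank_ker (evalForms (a + b + Fintype.card s) v)
  rw [LinearMap.range_eq_top.mpr hsurj, finrank_top, Module.finrank_pi,
    finrank_homogeneousSubmodule_fin_three] at h1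
  have h2 := Submodule.finrank_mono
    (range_pairMap_le_ker_evalForms (m := Fintype.card s) hA hB hvA hvB)
  have h3 := finrank_range_pairMap_add_eq (Fintype.card s) hA hB hA0 h
  rw [Fintype.card_coe] at *
  omega

theorem commonZeros_finite {a b : ℕ} {A B : MvPolynomial (Fin 3) ℂ}
    (hA : A.IsHomogeneous a) (hB : B.IsHomogeneous b) (hA0 : A ≠ 0) (h : IsRelPrime A B) :
    (commonZeros A B).Finite := by
  by_contra hinf
  obtain ⟨s, hs, hcard⟩ := Set.Infinite.exists_subset_card_eq hinf (a * b + 1)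
  have := card_le_of_subset_commonZeros hA hB hA0 h s hs
  omega

theorem derivation_eq_sum_pderiv {σ M : Type*} [Fintype σ] [AddCommGroup M] [Module ℂ M]
    [Module (MvPolynomial σ ℂ) M] [IsScalarTower ℂ (MvPolynomial σ ℂ) M]
    (D : Derivation ℂ (MvPolynomial σ ℂ) M) (q : MvPolynomial σ ℂ) :
    D q = ∑ j, pderiv j q • D (X j) := by
  classical
  have hsum : ∀ (d : σ → Derivation ℂ (MvPolynomial σ ℂ) M) q, (∑ j, d j) q = ∑ j, d j q := by
    intro d q
    have := congrFun (map_sum Derivation.coeFnAddMonoidHom d Finset.univ) q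
    exact this.trans (Finset.sum_apply _ _ _)
  have h : D = ∑ j, (LinearMap.toSpanSingleton _ M (D (X j))).compDer (pderiv j) := by
    refine derivation_ext fun i => ?_
    rw [hsum, Finset.sum_eq_single i]
    · simp
    · intro j _ hj
      simp [pderiv_X_of_ne hj.symm]
    · simp
  conv_lhs => rw [h]
  rw [hsum]
  rfl

/-- The Jacobian criterion for an ideal defining finitely many simple points. -/
theorem isRadical_span_range_of_det_ne_zero {σ : Type*} [Fintype σ] [DecidableEq σ]
    (p : σ → MvPolynomial σ ℂ)
    (h : ∀ P : σ → ℂ, (∀ i, eval P (p i) = 0) →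
      (Matrix.of fun i j => eval P (pderiv j (p i))).det ≠ 0) :
    (Ideal.span (Set.range p)).IsRadical := by
  set K := Ideal.span (Set.range p) with hK
  rw [Ideal.isRadical_iff_quotient_reduced]
  let M : Matrix σ σ (MvPolynomial σ ℂ) := Matrix.of fun i j => pderiv j (p i)
  have hdet : ∀ P : σ → ℂ, eval P M.det = (Matrix.of fun i j => eval P (pderiv j (p i))).det := by
    intro P
    rw [RingHom.map_det]
    rfl
  have htop : K ⊔ Ideal.span {M.det} = ⊤ := by
    rw [← Ideal.radical_eq_top, ← vanishingIdeal_zeroLocus_eq_radical (K := ℂ), Ideal.eq_top_iff_one]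
    intro P hP
    have h1 : ∀ q ∈ K ⊔ Ideal.span {M.det}, eval P q = 0 := fun q hq => by
      simpa [aeval_eq_eval] using hP q hq
    refine (h P (fun i => h1 _ ?_) ?_).elim
    · exact Ideal.mem_sup_left (Ideal.subset_span ⟨i, rfl⟩)
    · rw [← hdet]
      exact h1 _ (Ideal.mem_sup_right (Ideal.mem_span_singleton_self _))
  obtain ⟨k, hk, e, he, hke⟩ := Submodule.mem_sup.mp ((Ideal.eq_top_iff_one _).mp htop)
  obtain ⟨u, rfl⟩ := Ideal.mem_span_singleton'.mp he
  let D := (KaehlerDifferential.D ℂ (MvPolynomial σ ℂ ⧸ K)).compAlgebraMap (MvPolynomial σ ℂ)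
  have hD : ∀ q, D q = KaehlerDifferential.D ℂ (MvPolynomial σ ℂ ⧸ K) (Ideal.Quotient.mk K q) :=
    fun q => rfl
  have hsmul : ∀ q ∈ K, ∀ ω : Ω[MvPolynomial σ ℂ ⧸ K⁄ℂ], q • ω = 0 := fun q hq ω => by
    rw [← algebraMap_smul (MvPolynomial σ ℂ ⧸ K) q ω, Ideal.Quotient.algebraMap_eq,
      Ideal.Quotient.eq_zero_iff_mem.mpr hq]
    exact zero_smul (MvPolynomial σ ℂ ⧸ K) ω
  have hrel : ∀ i, ∑ j, M i j • D (X j) = 0 := fun i => by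
    have : D (p i) = 0 := by
      rw [hD, Ideal.Quotient.eq_zero_iff_mem.mpr (Ideal.subset_span (Set.mem_range_self i)), map_zero]
    rw [derivation_eq_sum_pderiv] at this
    exact this
  have hX : ∀ j, D (X j) = 0 := by
    intro j
    have h1 : ∑ l, (M.adjugate * M) j l • D (X l) = 0 := by
      simp_rw [Matrix.mul_apply, Finset.sum_smul, mul_smul]
      rw [Finset.sum_comm]
      simp_rw [← Finset.smul_sum, hrel, smul_zero, Finset.sum_const_zero]
    rw [Matrix.adjugate_mul, Finset.sum_eq_single j] at h1
    · simp only [Matrix.smul_apply, Matrix.one_apply_eq, smul_eq_mul, mul_one] at h1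
      rw [← one_smul (MvPolynomial σ ℂ) (D (X j)), ← hke, add_smul, hsmul k hk, zero_add, mul_smul,
        h1, smul_zero]
    · intro l _ hl
      simp [Matrix.one_apply_ne hl.symm]
    · simp
  have : Algebra.FormallyUnramified ℂ (MvPolynomial σ ℂ ⧸ K) := by
    constructor
    rw [← Submodule.subsingleton_iff (MvPolynomial σ ℂ ⧸ K), ← subsingleton_iff_bot_eq_top,
      ← KaehlerDifferential.span_range_derivation, eq_comm, Submodule.span_eq_bot]
    rintro _ ⟨q, rfl⟩
    obtain ⟨q, rfl⟩ := Ideal.Quotient.mk_surjective q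
    rw [← hD, derivation_eq_sum_pderiv]
    simp [hX]
  exact Algebra.FormallyUnramified.isReduced_of_field ℂ _

/-- Two plane curves meet transversally. -/
def Transversal (A B : MvPolynomial (Fin 3) ℂ) : Prop :=
  ∀ P : Fin 3 → ℂ, P ≠ 0 → eval P A = 0 → eval P B = 0 →
    LinearIndependent ℂ ![fun i => eval P (pderiv i A), fun i => eval P (pderiv i B)]

theorem Transversal.ne_zero {a b : ℕ} {A B : MvPolynomial (Fin 3) ℂ} (h : Transversal A B)
    (hA : A.IsHomogeneous a) (hB : B.IsHomogeneous b) (ha : 1 ≤ a) (hb : 1 ≤ b) : A ≠ 0 := by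
  rintro rfl
  obtain ⟨P, hP0, hPA, hPB⟩ := exists_common_zero hA hB ha hb
  refine (h P hP0 hPA hPB).ne_zero 0 ?_
  ext i
  simp

theorem Transversal.isRelPrime {a : ℕ} {A B : MvPolynomial (Fin 3) ℂ} (h : Transversal A B)
    (hA : A.IsHomogeneous a) (hA0 : A ≠ 0) : IsRelPrime A B := by
  intro g hgA hgB
  by_contra hg
  obtain ⟨k, m, r, -, hk, hr, hAr⟩ := hA.exists_of_dvd hA0 hgA
  have hg0 : g ≠ 0 := by rintro rfl; exact hA0 (zero_dvd_iff.mp hgA)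
  have hk1 : 1 ≤ k := by
    by_contra hk0
    obtain rfl : k = 0 := by omega
    exact hg (hk.isUnit_of_zero hg0)
  obtain ⟨P, hP0, hPg, -⟩ := exists_common_zero hk hk hk1 hk1
  obtain ⟨s, rfl⟩ := hgB
  have hli := h P hP0 (by rw [hAr, map_mul, hPg, zero_mul]) (by rw [map_mul, hPg, zero_mul])
  rw [LinearIndependent.pair_iff] at hli
  have h1 : ∀ r i, eval P (pderiv i (g * r)) = eval P r * eval P (pderiv i g) := fun r i => by
    rw [pderiv_mul, map_add, map_mul, map_mul, hPg]; ring
  have h2 := hli (eval P s) (-eval P r) (by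
    ext i
    simp only [hAr, h1, Pi.add_apply, Pi.smul_apply, smul_eq_mul, Pi.zero_apply]
    ring)
  have h3 := hli 1 0 (by
    ext i
    have : eval P r = 0 := by simpa using h2.2
    simp only [hAr, h1, this, Pi.add_apply, Pi.smul_apply, smul_eq_mul, Pi.zero_apply]
    ring)
  exact one_ne_zero h3.1

theorem mem_span_of_mem_span_sub_one {a b n : ℕ} {A B G l : MvPolynomial (Fin 3) ℂ}
    (hA : A.IsHomogeneous a) (hB : B.IsHomogeneous b) (hG : G.IsHomogeneous n)
    (hl : l.IsHomogeneous 1) (h : G ∈ Ideal.span {A, B, l - 1}) :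
    ∃ j, l ^ j * G ∈ Ideal.span {A, B} := by
  let R := Localization.Away l
  let ψ : MvPolynomial (Fin 3) ℂ →ₐ[ℂ] R := MvPolynomial.aeval fun i =>
    IsLocalization.Away.invSelf l * algebraMap (MvPolynomial (Fin 3) ℂ) R (X i)
  have hC : ∀ q, (MvPolynomial.aeval fun i => algebraMap _ R (X i : MvPolynomial (Fin 3) ℂ)) q =
      algebraMap (MvPolynomial (Fin 3) ℂ) R q := by
    intro q
    have : (MvPolynomial.aeval fun i => algebraMap _ R (X i : MvPolynomial (Fin 3) ℂ)) =
        (Algebra.ofId (MvPolynomial (Fin 3) ℂ) R).restrictScalars ℂ := by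
      ext i : 1
      simp [Algebra.ofId_apply]
    rw [this]; rfl
  have hψ : ∀ k (q : MvPolynomial (Fin 3) ℂ), q.IsHomogeneous k →
      ψ q = (IsLocalization.Away.invSelf l) ^ k * algebraMap _ R q := fun k q hq => by
    rw [← hC]; exact hq.aeval_mul _ _
  have hinv := IsLocalization.Away.mul_invSelf (S := R) l
  set I := Ideal.span {A, B}
  have hψmem : ψ G ∈ I.map (algebraMap _ R) := by
    suffices Ideal.span {A, B, l - 1} ≤ (I.map (algebraMap _ R)).comap ψ from this h
    rw [Ideal.span_le]
    have hI : ∀ q ∈ I, algebraMap _ R q ∈ I.map (algebraMap _ R) :=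
      fun q hq => Ideal.mem_map_of_mem _ hq
    rintro q (rfl | rfl | rfl)
    · rw [SetLike.mem_coe, Ideal.mem_comap, hψ a _ hA]
      exact Ideal.mul_mem_left _ _ (hI _ (Ideal.subset_span (by simp)))
    · rw [SetLike.mem_coe, Ideal.mem_comap, hψ b _ hB]
      exact Ideal.mul_mem_left _ _ (hI _ (Ideal.subset_span (by simp)))
    · have : ψ (l - 1) = 0 := by
        rw [map_sub, map_one, hψ 1 _ hl, pow_one, mul_comm, hinv, sub_self]
      simp [this]
  have hGmem : algebraMap _ R G ∈ I.map (algebraMap _ R) := by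
    have : algebraMap _ R G = (algebraMap _ R l) ^ n * ψ G := by
      rw [hψ n G hG, ← mul_assoc, ← mul_pow, hinv, one_pow, one_mul]
    rw [this]
    exact Ideal.mul_mem_left _ _ hψmem
  rw [IsLocalization.mem_map_algebraMap_iff (Submonoid.powers l)] at hGmem
  obtain ⟨⟨⟨x, hx⟩, ⟨_, j, rfl⟩⟩, he⟩ := hGmem
  rw [← map_mul, IsLocalization.eq_iff_exists (Submonoid.powers l)] at he
  obtain ⟨⟨_, k, rfl⟩, hk⟩ := he
  refine ⟨k + j, ?_⟩
  have : l ^ (k + j) * G = l ^ k * x := by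
    rw [← hk]; ring
  rw [this]
  exact Ideal.mul_mem_left _ _ hx

theorem IsHomogeneous.sum_mul_eval_pderiv {n : ℕ} {A : MvPolynomial (Fin 3) ℂ}
    (hA : A.IsHomogeneous n) (P : Fin 3 → ℂ) :
    ∑ i, P i * eval P (pderiv i A) = n * eval P A := by
  have := congrArg (eval P) hA.sum_X_mul_pderiv
  simpa using this

theorem mem_range_pairMap_iff {a b m : ℕ} {A B : MvPolynomial (Fin 3) ℂ}
    (hA : A.IsHomogeneous a) (hB : B.IsHomogeneous b)
    (G : homogeneousSubmodule (Fin 3) ℂ (a + b + m)) :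
    G ∈ LinearMap.range (pairMap m hA hB) ↔
      (G : MvPolynomial (Fin 3) ℂ) ∈ Ideal.span {A, B} := by
  constructor
  · rintro ⟨⟨u, v⟩, rfl⟩
    exact Ideal.mem_span_pair.mpr ⟨u, v, rfl⟩
  · intro h
    obtain ⟨u, v, hu, hv, huv⟩ := exists_isHomogeneous_of_mem_span_pair hA hB G.2 h
    exact ⟨(⟨u, hu⟩, ⟨v, hv⟩), Subtype.ext huv.symm⟩

/-- A linear form without common zeros with two coprime forms is a nonzerodivisor modulo them in
large degrees. -/
theorem exists_forall_mem_span_of_mul_mem {a b : ℕ} {A B l : MvPolynomial (Fin 3) ℂ}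
    (hA : A.IsHomogeneous a) (hB : B.IsHomogeneous b) (hA0 : A ≠ 0) (h : IsRelPrime A B)
    (hl : l.IsHomogeneous 1)
    (hno : ∀ P : Fin 3 → ℂ, eval P A = 0 → eval P B = 0 → eval P l = 0 → P = 0) :
    ∃ N, ∀ m, N ≤ m → ∀ G : MvPolynomial (Fin 3) ℂ, G.IsHomogeneous (a + b + m) →
      l * G ∈ Ideal.span {A, B} → G ∈ Ideal.span {A, B} := by
  have hJ : ∀ P : Fin 3 → ℂ, (∀ p ∈ Ideal.span {A, B, l}, eval P p = 0) → P = 0 := fun P hP =>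
    hno P (hP A (Ideal.subset_span (by simp))) (hP B (Ideal.subset_span (by simp)))
      (hP l (Ideal.subset_span (by simp)))
  obtain ⟨N, hN⟩ := exists_forall_isHomogeneous_mem hJ
  refine ⟨N, fun m hm G hG hlG => ?_⟩
  let μ : homogeneousSubmodule (Fin 3) ℂ (a + b + m) →ₗ[ℂ]
    homogeneousSubmodule (Fin 3) ℂ (a + b + (m + 1)) := mulForm hl (by ring)
  let g := (LinearMap.range (pairMap (m + 1) hA hB)).mkQ ∘ₗ μ
  have hsurj : Function.Surjective g := by
    intro q
    obtain ⟨⟨H, hH⟩, rfl⟩ := Submodule.mkQ_surjective _ q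
    rw [mem_homogeneousSubmodule] at hH
    have hmem := hN _ (by omega) H hH
    obtain ⟨u, z, hz, hHu⟩ := Ideal.mem_span_insert.mp hmem
    obtain ⟨v, w, rfl⟩ := Ideal.mem_span_pair.mp hz
    refine ⟨⟨homogeneousComponent (a + b + m) w, homogeneousComponent_isHomogeneous _ _⟩, ?_⟩
    refine ((Submodule.Quotient.eq _).mpr ?_).symm
    rw [mem_range_pairMap_iff]
    have h2 : H = homogeneousComponent (b + (m + 1)) u * A +
        (homogeneousComponent (a + (m + 1)) v * B + homogeneousComponent (a + b + m) w * l) := by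
      rw [← homogeneousComponent_mul_of_isHomogeneous hA,
        ← homogeneousComponent_mul_of_isHomogeneous hB,
        ← homogeneousComponent_mul_of_isHomogeneous hl,
        show b + (m + 1) + a = a + b + (m + 1) by ring,
        show a + (m + 1) + b = a + b + (m + 1) by ring,
        show a + b + m + 1 = a + b + (m + 1) by ring, ← map_add, ← map_add, ← hHu,
        homogeneousComponent_eq_self hH]
    refine Ideal.mem_span_pair.mpr ⟨homogeneousComponent (b + (m + 1)) u,
      homogeneousComponent (a + (m + 1)) v, ?_⟩
    simp only [μ, AddSubgroupClass.coe_sub, coe_mulForm]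
    conv_rhs => rw [h2]
    ring
  have h1 := LinearMap.finrank_range_add_finrank_ker g
  have h2 := (LinearMap.range (pairMap (m + 1) hA hB)).finrank_quotient_add_finrank
  have h3 := finrank_range_pairMap_add_eq m hA hB hA0 h
  have h4 := finrank_range_pairMap_add_eq (m + 1) hA hB hA0 h
  rw [LinearMap.range_eq_top.mpr hsurj, finrank_top] at h1
  rw [finrank_homogeneousSubmodule_fin_three] at h1 h2
  have hker : ∀ H, H ∈ LinearMap.ker g ↔
      l * (H : MvPolynomial (Fin 3) ℂ) ∈ Ideal.span {A, B} := by
    intro H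
    rw [LinearMap.mem_ker, mul_comm, LinearMap.comp_apply, Submodule.mkQ_apply,
      Submodule.Quotient.mk_eq_zero, mem_range_pairMap_iff]
    rfl
  have hle : LinearMap.range (pairMap m hA hB) ≤ LinearMap.ker g := by
    intro H hH
    rw [hker]
    exact Ideal.mul_mem_left _ _ ((mem_range_pairMap_iff hA hB H).mp hH)
  have heq := Submodule.eq_of_le_of_finrank_eq hle (by omega)
  have := (hker ⟨G, hG⟩).mpr hlG
  rw [← heq, mem_range_pairMap_iff] at this
  exact this

theorem Transversal.isRadical_span {a b : ℕ} {A B l : MvPolynomial (Fin 3) ℂ}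
    (h : Transversal A B) (hA : A.IsHomogeneous a) (hB : B.IsHomogeneous b)
    (hl : l.IsHomogeneous 1) : (Ideal.span {A, B, l - 1}).IsRadical := by
  have hrange : Set.range ![A, B, l - 1] = {A, B, l - 1} := by
    ext q
    simp only [Matrix.range_cons, Matrix.range_empty, Set.mem_union, Set.mem_insert_iff,
      Set.mem_singleton_iff, Set.mem_empty_iff_false, or_false]
  rw [← hrange]
  refine isRadical_span_range_of_det_ne_zero _ fun P hP hdet => ?_
  have hPA : eval P A = 0 := hP 0
  have hPB : eval P B = 0 := hP 1
  have hPl : eval P l = 1 := by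
    have : eval P (l - 1) = 0 := hP 2
    rwa [map_sub, map_one, sub_eq_zero] at this
  have hP0 : P ≠ 0 := by
    rintro rfl
    have := hl.eval_smul 0 0
    rw [smul_zero, hPl] at this
    simp at this
  obtain ⟨w, hw0, hw⟩ := Matrix.exists_vecMul_eq_zero_iff.mpr hdet
  have hw' : ∀ i, w 0 * eval P (pderiv i A) + w 1 * eval P (pderiv i B) +
      w 2 * eval P (pderiv i l) = 0 := by
    intro i
    have := congrFun hw i
    simpa [Matrix.vecMul, dotProduct, Fin.sum_univ_three] using this
  have hw2 : w 2 = 0 := by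
    have h1 := hA.sum_mul_eval_pderiv P
    have h2 := hB.sum_mul_eval_pderiv P
    have h3 := hl.sum_mul_eval_pderiv P
    rw [hPA] at h1
    rw [hPB] at h2
    rw [hPl] at h3
    simp only [Fin.sum_univ_three] at h1 h2 h3
    push_cast at h3
    linear_combination -w 0 * h1 - w 1 * h2 - w 2 * h3 + P 0 * hw' 0 + P 1 * hw' 1 + P 2 * hw' 2
  have := LinearIndependent.pair_iff.mp (h P hP0 hPA hPB) (w 0) (w 1) (by
    ext i
    simpa [hw2] using hw' i)
  refine hw0 ?_
  ext i
  fin_cases i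
  exacts [this.1, this.2, hw2]

/-- The Bézout theorem for transversal plane curves. -/
theorem Transversal.ncard_commonZeros {a b : ℕ} {A B : MvPolynomial (Fin 3) ℂ}
    (h : Transversal A B) (hA : A.IsHomogeneous a) (hB : B.IsHomogeneous b) (ha : 1 ≤ a)
    (hb : 1 ≤ b) : (commonZeros A B).Finite ∧ (commonZeros A B).ncard = a * b := by
  have hA0 := h.ne_zero hA hB ha hb
  have hrel := h.isRelPrime hA hA0
  have hfin := commonZeros_finite hA hB hA0 hrel
  refine ⟨hfin, le_antisymm ?_ ?_⟩
  · rw [Set.ncard_eq_toFinset_card _ hfin]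
    exact card_le_of_subset_commonZeros hA hB hA0 hrel _ (by simp)
  have : Fintype (commonZeros A B) := hfin.fintype
  choose v hv0 hvL hvA hvB using fun L : commonZeros A B => L.2
  obtain ⟨f, hf⟩ := Module.exists_dual_forall_apply_ne_zero (K := ℂ) v hv0
  have hpoint : ∀ P : Fin 3 → ℂ, P ≠ 0 → eval P A = 0 → eval P B = 0 →
      ∃ i, ∃ c : ℂ, c ≠ 0 ∧ P = c • v i := by
    intro P hP0 hPA hPB
    let i : commonZeros A B := ⟨Submodule.span ℂ {P}, P, hP0, rfl, hPA, hPB⟩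
    have hmem : P ∈ Submodule.span ℂ {v i} := by
      rw [← hvL]; exact Submodule.mem_span_singleton_self P
    obtain ⟨c, hc⟩ := Submodule.mem_span_singleton.mp hmem
    refine ⟨i, c, ?_, hc.symm⟩
    rintro rfl
    exact hP0 (by rw [← hc, zero_smul])
  have hl := isHomogeneous_linearForm f
  obtain ⟨N, hN⟩ := exists_forall_mem_span_of_mul_mem hA hB hA0 hrel hl (by
    intro P hPA hPB hPl
    by_contra hP0
    obtain ⟨i, c, hc, rfl⟩ := hpoint P hP0 hPA hPB
    rw [eval_linearForm, map_smul] at hPl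
    exact smul_ne_zero hc (hf i) hPl)
  have hpow : ∀ j m, N ≤ m → ∀ G : MvPolynomial (Fin 3) ℂ, G.IsHomogeneous (a + b + m) →
      linearForm f ^ j * G ∈ Ideal.span {A, B} → G ∈ Ideal.span {A, B} := by
    intro j
    induction j with
    | zero => intro m _ G _ h; simpa using h
    | succ j ih =>
      intro m hm G hG h
      refine hN m hm G hG (ih (m + 1) (by omega) _ ?_ ?_)
      · have := hl.mul hG
        rwa [show 1 + (a + b + m) = a + b + (m + 1) by ring] at this
      · rwa [← mul_assoc, ← pow_succ]
  have hker : LinearMap.ker (evalForms (a + b + N) v) ≤ LinearMap.range (pairMap N hA hB) := by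
    rintro ⟨G, hG⟩ hGker
    rw [mem_range_pairMap_iff]
    rw [mem_homogeneousSubmodule] at hG
    have hGv : ∀ i, eval (v i) G = 0 := fun i => by
      have := congrFun (LinearMap.mem_ker.mp hGker) i
      rwa [evalForms_apply] at this
    have hmem : G ∈ Ideal.span {A, B, linearForm f - 1} := by
      rw [← (h.isRadical_span hA hB hl).radical, ← vanishingIdeal_zeroLocus_eq_radical (K := ℂ)]
      intro P hP
      have h1 : ∀ q ∈ ({A, B, linearForm f - 1} : Set _), eval P q = 0 := fun q hq => by
        simpa [aeval_eq_eval] using hP q (Ideal.subset_span hq)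
      have hPl := h1 (linearForm f - 1) (by simp)
      rw [map_sub, map_one, eval_linearForm, sub_eq_zero] at hPl
      obtain ⟨i, c, -, rfl⟩ := hpoint P (by rintro rfl; simp at hPl) (h1 A (by simp))
        (h1 B (by simp))
      rw [aeval_eq_eval]
      change eval (c • v i) G = 0
      rw [hG.eval_smul, hGv, mul_zero]
    obtain ⟨j, hj⟩ := mem_span_of_mem_span_sub_one hA hB hG hl hmem
    exact hpow j N le_rfl G hG hj
  have h1 := LinearMap.finrank_range_add_finrank_ker (evalForms (a + b + N) v)
  have h2 := Submodule.finrank_mono hker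
  have h3 := finrank_range_pairMap_add_eq N hA hB hA0 hrel
  have h4 := (LinearMap.range (evalForms (a + b + N) v)).finrank_le
  rw [Module.finrank_pi] at h4
  rw [finrank_homogeneousSubmodule_fin_three] at h1
  rw [← Nat.card_coe_set_eq, Nat.card_eq_fintype_card]
  omega

/-- A form defines a smooth curve if its gradient vanishes only at the origin. -/
def Smooth (F : MvPolynomial (Fin 3) ℂ) : Prop :=
  ∀ P : Fin 3 → ℂ, (∀ i, eval P (pderiv i F) = 0) → P = 0

/-- Generic smoothness for the pencil of pairs `(C + γ D, T - γ R)`. -/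
theorem finite_setOf_degenerate (C' D T R : MvPolynomial (Fin 3) ℂ) :
    {γ : ℂ | ∃ (P : Fin 3 → ℂ) (a b : ℂ), eval P C' + γ * eval P D = 0 ∧
      eval P T - γ * eval P R = 0 ∧
      (∀ i, a * (eval P (pderiv i C') + γ * eval P (pderiv i D)) +
        b * (eval P (pderiv i T) - γ * eval P (pderiv i R)) = 0) ∧
      a * eval P D - b * eval P R ≠ 0}.Finite := by
  let σ := Fin 3 ⊕ Fin 3
  let ρ : MvPolynomial (Fin 3) ℂ → MvPolynomial σ ℂ := rename Sum.inl
  let y : Fin 3 → MvPolynomial σ ℂ := fun i => X (Sum.inr i)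
  let E : Set (MvPolynomial σ ℂ) :=
    {ρ C' + y 0 * ρ D, ρ T - y 0 * ρ R} ∪ Set.range fun i =>
      y 1 * (ρ (pderiv i C') + y 0 * ρ (pderiv i D)) +
        y 2 * (ρ (pderiv i T) - y 0 * ρ (pderiv i R))
  refine (finite_values_of_forall_derivation_eq_zero E (y 1 * ρ D - y 2 * ρ R) (y 0) ?_).subset ?_
  · intro L _ _ δ v hE hq
    have hρ : ∀ p, aeval v (ρ p) = aeval (v ∘ Sum.inl) p := fun p => aeval_rename _ _ _
    have hy : ∀ i, aeval v (y i) = v (Sum.inr i) := fun i => aeval_X _ _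
    have h1 := hE (ρ C' + y 0 * ρ D) (by simp [E])
    have h2 := hE (ρ T - y 0 * ρ R) (by simp [E])
    have h3 := fun i => hE _ (Set.mem_union_right _ (Set.mem_range_self i))
    simp only [map_add, map_sub, map_mul, hρ, hy] at h1 h2 h3 hq ⊢
    have d1 := congrArg δ h1
    have d2 := congrArg δ h2
    simp only [map_add, map_sub, map_zero, Derivation.leibniz, smul_eq_mul,
      Derivation.apply_aeval_mvPolynomial, Fin.sum_univ_three, Function.comp_apply] at d1 d2
    refine (mul_eq_zero.mp ?_).resolve_left hq
    linear_combination v (Sum.inr 1) * d1 + v (Sum.inr 2) * d2 - δ (v (Sum.inl 0)) * h3 0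
      - δ (v (Sum.inl 1)) * h3 1 - δ (v (Sum.inl 2)) * h3 2
  · rintro γ ⟨P, a, b, h1, h2, h3, hq⟩
    have hρ : ∀ p, eval (Sum.elim P ![γ, a, b]) (ρ p) = eval P p := fun p => by
      simp only [ρ, eval_rename, Sum.elim_comp_inl]
    have hy : ∀ i, eval (Sum.elim P ![γ, a, b]) (y i) = ![γ, a, b] i := fun i => by simp [y]
    refine ⟨Sum.elim P ![γ, a, b], ?_, ?_, hy 0⟩
    · rintro e ((rfl | rfl) | ⟨i, rfl⟩)
      · simpa [hρ, hy] using h1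
      · simpa [hρ, hy] using h2
      · simpa [hρ, hy] using h3 i
    · simpa [hρ, hy] using hq

theorem exists_generic_transversal {F C' D T R : MvPolynomial (Fin 3) ℂ} (hF : Smooth F)
    (h : F = C' * R + D * T) : ∃ γ : ℂ, Transversal (C' + C γ * D) (T - C γ * R) := by
  obtain ⟨γ, hγ⟩ := (finite_setOf_degenerate C' D T R).exists_notMem
  refine ⟨γ, fun P hP0 hU hV => ?_⟩
  rw [LinearIndependent.pair_iff]
  intro a b hab
  have hab' : ∀ i, a * (eval P (pderiv i C') + γ * eval P (pderiv i D)) +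
        b * (eval P (pderiv i T) - γ * eval P (pderiv i R)) = 0 := fun i => by
    simpa using congrFun hab i
  simp only [map_add, map_sub, map_mul, eval_C] at hU hV
  have hq : a * eval P D - b * eval P R = 0 := by
    by_contra hq
    exact hγ ⟨P, a, b, hU, hV, hab', hq⟩
  have hgrad : ∀ i, eval P (pderiv i F) =
      eval P R * (eval P (pderiv i C') + γ * eval P (pderiv i D)) +
        eval P D * (eval P (pderiv i T) - γ * eval P (pderiv i R)) := fun i => by
    rw [h]
    simp only [map_add, pderiv_mul, map_mul]
    linear_combination eval P (pderiv i R) * hU + eval P (pderiv i D) * hV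
  constructor
  · by_contra ha
    refine hP0 (hF P fun i => (mul_eq_zero.mp (?_ : a * _ = 0)).resolve_left ha)
    rw [hgrad]
    linear_combination eval P R * hab' i +
      (eval P (pderiv i T) - γ * eval P (pderiv i R)) * hq
  · by_contra hb
    refine hP0 (hF P fun i => (mul_eq_zero.mp (?_ : b * _ = 0)).resolve_left hb)
    rw [hgrad]
    linear_combination eval P D * hab' i -
      (eval P (pderiv i C') + γ * eval P (pderiv i D)) * hq

theorem Transversal.finite_setOf_not_smooth {d : ℕ} {U V : MvPolynomial (Fin 3) ℂ}
    (hd : 1 ≤ d) (hU : U.IsHomogeneous d) (hV : V.IsHomogeneous d) (h : Transversal U V) :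
    {μ : ℂ | ¬ Smooth (U + C μ * V)}.Finite := by
  refine (finite_setOf_degenerate U V 0 0).subset ?_
  intro μ hμ
  simp only [Smooth, not_forall, Set.mem_ofPred_eq] at hμ
  obtain ⟨P, hP, hP0⟩ := hμ
  have hP' : ∀ i, eval P (pderiv i U) + μ * eval P (pderiv i V) = 0 := fun i => by
    simpa using hP i
  have h0 : eval P U + μ * eval P V = 0 := by
    have h1 := hU.sum_mul_eval_pderiv P
    have h2 := hV.sum_mul_eval_pderiv P
    simp only [Fin.sum_univ_three] at h1 h2
    refine (mul_eq_zero.mp (?_ : (d : ℂ) * _ = 0)).resolve_left (by exact_mod_cast (by omega))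
    linear_combination -h1 - μ * h2 + P 0 * hP' 0 + P 1 * hP' 1 + P 2 * hP' 2
  refine ⟨P, 1, 0, h0, by simp, fun i => by simpa using hP' i, ?_⟩
  simp only [one_mul, map_zero, mul_zero, sub_zero]
  intro hV0
  rw [hV0, mul_zero, add_zero] at h0
  have := LinearIndependent.pair_iff.mp (h P hP0 h0 hV0) 1 μ (by
    ext i
    simpa using hP' i)
  exact one_ne_zero this.1

theorem Transversal.finite_setOf_ratio {d : ℕ} {U V D R : MvPolynomial (Fin 3) ℂ}
    (hd : 1 ≤ d) (hU : U.IsHomogeneous d) (hV : V.IsHomogeneous d) (hD : D.IsHomogeneous d)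
    (hR : R.IsHomogeneous d) (h : Transversal U V) (hF : Smooth (U * R + D * V)) :
    {μ : ℂ | ∃ P : Fin 3 → ℂ, P ≠ 0 ∧ eval P U = 0 ∧ eval P V = 0 ∧
      eval P D = μ * eval P R}.Finite := by
  obtain ⟨hfin, -⟩ := h.ncard_commonZeros hU hV hd hd
  choose v hv0 hvL hvU hvV using fun L : commonZeros U V => L.2
  have := hfin.to_subtype
  refine (Set.finite_range fun L => eval (v L) D / eval (v L) R).subset ?_
  rintro μ ⟨P, hP0, hPU, hPV, hPD⟩
  let L : commonZeros U V := ⟨Submodule.span ℂ {P}, P, hP0, rfl, hPU, hPV⟩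
  have hmem : P ∈ Submodule.span ℂ {v L} := by
    rw [← hvL]; exact Submodule.mem_span_singleton_self P
  obtain ⟨c, hc⟩ := Submodule.mem_span_singleton.mp hmem
  have hc0 : c ^ d ≠ 0 := by
    refine pow_ne_zero _ ?_
    rintro rfl
    exact hP0 (by rw [← hc, zero_smul])
  rw [← hc, hD.eval_smul, hR.eval_smul] at hPD
  have hDR : eval (v L) D = μ * eval (v L) R := by
    apply mul_left_cancel₀ hc0
    linear_combination hPD
  refine ⟨L, ?_⟩
  have hR0 : eval (v L) R ≠ 0 := by
    intro hR0
    rw [hR0, mul_zero] at hDR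
    refine hv0 L (hF _ fun i => ?_)
    simp [hR0, hDR, hvU, hvV]
  change eval (v L) D / eval (v L) R = μ
  rw [hDR, mul_div_assoc, div_self hR0, mul_one]

theorem exists_generic_transversal_of_smooth {F₁ F₂ G : MvPolynomial (Fin 3) ℂ}
    (hF₂ : Smooth F₂)
    (h : ∀ P : Fin 3 → ℂ, eval P F₁ = 0 → eval P F₂ = 0 → eval P G = 0 → P = 0) :
    ∃ κ : ℂ, Transversal F₂ (G + C κ * F₁) := by
  obtain ⟨κ, hκ⟩ := (finite_setOf_degenerate F₂ 0 G (-F₁)).exists_notMem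
  refine ⟨κ, fun P hP0 hU hV => ?_⟩
  rw [LinearIndependent.pair_iff]
  intro a b hab
  have hab' : ∀ i, a * eval P (pderiv i F₂) +
      b * (eval P (pderiv i G) + κ * eval P (pderiv i F₁)) = 0 := fun i => by
    simpa using congrFun hab i
  simp only [map_add, map_mul, eval_C] at hV
  have hF₁ : eval P F₁ ≠ 0 := fun h1 => hP0 (h P h1 hU (by simpa [h1] using hV))
  have hb : b = 0 := by
    by_contra hb
    refine hκ ⟨P, a, b, by simpa using hU, by simpa using hV, fun i => by simpa using hab' i, ?_⟩
    simpa using ⟨hb, hF₁⟩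
  refine ⟨?_, hb⟩
  by_contra ha
  exact hP0 (hF₂ P fun i => by simpa [hb, ha] using hab' i)

theorem exists_general_position {d : ℕ} (hd : 1 ≤ d) {F C' D T R : MvPolynomial (Fin 3) ℂ}
    (hF : Smooth F) (hC : C'.IsHomogeneous d) (hD : D.IsHomogeneous d) (hT : T.IsHomogeneous d)
    (hR : R.IsHomogeneous d) (h : F = C' * R + D * T) :
    ∃ F₁ G₁ F₂ G₂ : MvPolynomial (Fin 3) ℂ,
      F₁.IsHomogeneous d ∧ G₁.IsHomogeneous d ∧ F₂.IsHomogeneous d ∧ G₂.IsHomogeneous d ∧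
      F = F₁ * G₁ + F₂ * G₂ ∧ Smooth F₁ ∧ Transversal F₂ G₂ := by
  have hCmul : ∀ (c : ℂ) {A : MvPolynomial (Fin 3) ℂ}, A.IsHomogeneous d →
      (C c * A).IsHomogeneous d := fun c A hA => by
    simpa using (isHomogeneous_C (Fin 3) c).mul hA
  obtain ⟨γ, hγ⟩ := exists_generic_transversal hF h
  have hU := hC.add (hCmul γ hD)
  have hV := hT.sub (hCmul γ hR)
  set U := C' + C γ * D with hUdef
  set V := T - C γ * R with hVdef
  have hFUV : F = U * R + D * V := by rw [h, hUdef, hVdef]; ring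
  have hfin := hγ.finite_setOf_not_smooth hd hU hV
  obtain ⟨μ, hμ⟩ := (hfin.union (hγ.finite_setOf_ratio hd hU hV hD hR (hFUV ▸ hF))).exists_notMem
  obtain ⟨ν, hν⟩ := (hfin.union (Set.finite_singleton μ)).exists_notMem
  simp only [Set.mem_union, Set.mem_ofPred_eq, not_or, not_not, Set.mem_singleton_iff] at hμ hν
  obtain ⟨hμs, hμr⟩ := hμ
  obtain ⟨hνs, hνμ⟩ := hν
  have hne : μ - ν ≠ 0 := sub_ne_zero.mpr (Ne.symm hνμ)
  set F₁ := U + C μ * V with hF₁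
  set F₂ := U + C ν * V with hF₂
  set G := C (μ - ν)⁻¹ * (C μ * R - D) with hG
  obtain ⟨κ, hκ⟩ := exists_generic_transversal_of_smooth (F₁ := F₁) (G := G) hνs (by
    intro P h1 h2 h3
    by_contra hP0
    simp only [hF₁, hF₂, hG, map_add, map_sub, map_mul, eval_C, mul_eq_zero, inv_eq_zero, hne,
      false_or] at h1 h2 h3
    have hPV : eval P V = 0 := by
      refine (mul_eq_zero.mp (?_ : (μ - ν) * _ = 0)).resolve_left hne
      linear_combination h1 - h2
    refine hμr ⟨P, hP0, ?_, hPV, ?_⟩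
    · linear_combination h1 - μ * hPV
    · linear_combination -h3)
  have h1 : F₁.IsHomogeneous d := hU.add (hCmul μ hV)
  have h2 : F₂.IsHomogeneous d := hU.add (hCmul ν hV)
  refine ⟨F₁, C (μ - ν)⁻¹ * (D - C ν * R) - C κ * F₂, F₂, G + C κ * F₁, h1, ?_, h2, ?_, ?_, hμs, hκ⟩
  · exact (hCmul _ (hD.sub (hCmul ν hR))).sub (hCmul _ h2)
  · exact (hCmul _ ((hCmul μ hR).sub hD)).add (hCmul _ h1)
  · have hinv : C (μ - ν)⁻¹ * (C μ - C ν) = (1 : MvPolynomial (Fin 3) ℂ) := by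
      rw [← C_sub, ← C_mul, inv_mul_cancel₀ hne, C_1]
    rw [hFUV, hF₁, hF₂, hG]
    linear_combination -(U * R + D * V) * hinv

end MvPolynomial

theorem isOpen_setOf_continuousLinearMap_surjective {V W : Type*} [NormedAddCommGroup V]
    [NormedSpace ℂ V] [NormedAddCommGroup W] [NormedSpace ℂ W] [FiniteDimensional ℂ W] :
    IsOpen {f : V →L[ℂ] W | Function.Surjective f} := by
  have : {f : V →L[ℂ] W | Function.Surjective f} =
      {f : V →L[ℂ] W | ((Module.finrank ℂ W : ℕ) : Cardinal) ≤ (f : V →ₗ[ℂ] W).rank} := by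
    ext f
    simp only [Set.mem_ofPred_eq]
    rw [LinearMap.rank, ← Module.finrank_eq_rank, Nat.cast_le]
    constructor
    · intro h
      rw [LinearMap.range_eq_top.mpr h, finrank_top]
    · intro h
      have := Submodule.eq_top_of_finrank_eq (le_antisymm (Submodule.finrank_le _) h)
      exact LinearMap.range_eq_top.mp this
  rw [this]
  exact isOpen_setOfPred_nat_le_rank _

/-- A solution at which a one-parameter family of maps is submersive deforms to nonzero values of
the parameter. -/
theorem exists_ne_zero_and_surjective_of_contDiff {V W : Type*} [NormedAddCommGroup V]
    [NormedSpace ℂ V] [CompleteSpace V] [NormedAddCommGroup W] [NormedSpace ℂ W]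
    [FiniteDimensional ℂ W] {Φ : ℂ × V → W} (hΦ : ContDiff ℂ 1 Φ) {v₀ : V}
    {L : ℂ → V → V → W}
    (hL : ∀ t v δ, HasDerivAt (fun s : ℂ => Φ (t, v + s • δ)) (L t v δ) 0)
    (hsurj : Function.Surjective (L 0 v₀)) :
    ∃ t ≠ 0, ∃ v, Φ (t, v) = Φ (0, v₀) ∧ Function.Surjective (L t v) := by
  have : CompleteSpace W := FiniteDimensional.complete ℂ W
  let Ψ : ℂ × V → ℂ × W := fun x => (x.1, Φ x)
  have hΨ : ContDiff ℂ 1 Ψ := contDiff_fst.prodMk hΦ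
  have hdΦ : ∀ x : ℂ × V, HasFDerivAt Φ (fderiv ℂ Φ x) x := fun x =>
    (hΦ.differentiable one_ne_zero x).hasFDerivAt
  have hdΨ : ∀ x : ℂ × V, fderiv ℂ Ψ x =
      (ContinuousLinearMap.fst ℂ ℂ V).prod (fderiv ℂ Φ x) := fun x =>
    (hasFDerivAt_fst.prodMk (hdΦ x)).fderiv
  have hLΦ : ∀ t v δ, fderiv ℂ Φ (t, v) (0, δ) = L t v δ := by
    intro t v δ
    refine HasDerivAt.unique ?_ (hL t v δ)
    have h1 : HasDerivAt (fun s : ℂ => ((t, v + s • δ) : ℂ × V)) (0, δ) 0 := by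
      refine (hasDerivAt_const _ _).prodMk ?_
      simpa using ((hasDerivAt_id (0 : ℂ)).smul_const δ).const_add v
    have h2 := hdΦ (t, v)
    have h3 : HasFDerivAt Φ (fderiv ℂ Φ (t, v)) ((fun s : ℂ => ((t, v + s • δ) : ℂ × V)) 0) := by
      simpa using h2
    exact h3.comp_hasDerivAt (0 : ℂ) h1
  have hiff : ∀ t v, Function.Surjective (fderiv ℂ Ψ (t, v)) ↔ Function.Surjective (L t v) := by
    intro t v
    rw [hdΨ]
    constructor
    · intro h w
      obtain ⟨⟨τ, δ⟩, hδ⟩ := h (0, w)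
      simp only [ContinuousLinearMap.prod_apply, ContinuousLinearMap.coe_fst', Prod.mk.injEq] at hδ
      obtain ⟨rfl, hδ⟩ := hδ
      exact ⟨δ, by rw [← hLΦ, hδ]⟩
    · rintro h ⟨τ, w⟩
      obtain ⟨δ, hδ⟩ := h (w - fderiv ℂ Φ (t, v) (τ, 0))
      refine ⟨(τ, δ), ?_⟩
      simp only [ContinuousLinearMap.prod_apply, ContinuousLinearMap.coe_fst', Prod.mk.injEq,
        true_and]
      have : ((τ, δ) : ℂ × V) = (τ, 0) + (0, δ) := by simp
      rw [this, map_add, hLΦ, hδ]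
      abel
  have hopen : {x | Function.Surjective (fderiv ℂ Ψ x)} ∈ nhds ((0, v₀) : ℂ × V) :=
    (isOpen_setOf_continuousLinearMap_surjective.preimage
      (hΨ.continuous_fderiv one_ne_zero)).mem_nhds ((hiff _ _).mpr hsurj)
  have hmap := (hΨ.contDiffAt.hasStrictFDerivAt (x := ((0, v₀) : ℂ × V))
    one_ne_zero).map_nhds_eq_of_surj (LinearMap.range_eq_top.mpr ((hiff 0 v₀).mpr hsurj))
  have himg := Filter.image_mem_map (m := Ψ) hopen
  rw [hmap] at himg
  have hcont : Filter.Tendsto (fun t : ℂ => ((t, Φ (0, v₀)) : ℂ × W)) (nhds 0)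
      (nhds (Ψ (0, v₀))) :=
    (Continuous.prodMk continuous_id continuous_const).tendsto' _ _ rfl
  have hev : ∀ᶠ t : ℂ in nhdsWithin 0 {0}ᶜ,
      ((t, Φ (0, v₀)) : ℂ × W) ∈ Ψ '' {x | Function.Surjective (fderiv ℂ Ψ x)} :=
    (hcont.eventually himg).filter_mono nhdsWithin_le_nhds
  obtain ⟨t, ⟨⟨s, v⟩, hx, hxt⟩, ht⟩ := (hev.and self_mem_nhdsWithin).exists
  simp only [Ψ, Prod.mk.injEq] at hxt
  obtain ⟨rfl, hxt⟩ := hxt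
  exact ⟨s, ht, v, hxt, (hiff _ _).mp hx⟩

namespace MvPolynomial

theorem IsHomogeneous.natDegree_aeval_le_and_coeff {n : ℕ} {G : MvPolynomial (Fin 3) ℂ}
    (hG : G.IsHomogeneous n) {w : Fin 3 → Polynomial ℂ} (hw : ∀ i, (w i).natDegree ≤ 1) :
    (MvPolynomial.aeval w G).natDegree ≤ n ∧
      (MvPolynomial.aeval w G).coeff n = eval (fun i => (w i).coeff 1) G := by
  have key : ∀ e ∈ G.support,
      (Polynomial.C (coeff e G) * ∏ i, w i ^ e i).natDegree ≤ n ∧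
      (Polynomial.C (coeff e G) * ∏ i, w i ^ e i).coeff n =
        coeff e G * ∏ i, (w i).coeff 1 ^ e i := by
    intro e he
    have h : n = e 0 + e 1 + e 2 := by
      rw [← hG (mem_support_iff.mp he), Finsupp.weight_apply, Finsupp.sum_fintype _ _ (by simp),
        Fin.sum_univ_three]
      simp
    have hp : ∀ i, (w i ^ e i).natDegree ≤ e i := fun i =>
      (Polynomial.natDegree_pow_le_of_le _ (hw i)).trans (by simp)
    have hc : ∀ i, (w i ^ e i).coeff (e i) = (w i).coeff 1 ^ e i := fun i => by
      simpa using Polynomial.coeff_pow_of_natDegree_le (m := e i) (hw i)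
    have h01 := Polynomial.natDegree_mul_le_of_le (hp 0) (hp 1)
    rw [Fin.prod_univ_three, Fin.prod_univ_three, h]
    refine ⟨(Polynomial.natDegree_C_mul_le _ _).trans
      (Polynomial.natDegree_mul_le_of_le h01 (hp 2)), ?_⟩
    rw [Polynomial.coeff_C_mul, Polynomial.coeff_mul_add_eq_of_natDegree_le h01 (hp 2),
      Polynomial.coeff_mul_add_eq_of_natDegree_le (hp 0) (hp 1), hc, hc, hc]
  rw [aeval_def, eval₂_eq', eval_eq']
  constructor
  · exact Polynomial.natDegree_sum_le_of_forall_le _ _ fun e he => (key e he).1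
  · rw [Polynomial.finsetSum_coeff]
    exact Finset.sum_congr rfl fun e he => (key e he).2

/-- The restriction to the line `z = α x + β y`, in the affine coordinate `y / x`. -/
noncomputable def lineRestrict (α β : ℂ) : MvPolynomial (Fin 3) ℂ →ₐ[ℂ] Polynomial ℂ :=
  MvPolynomial.aeval ![1, Polynomial.X, Polynomial.C α + Polynomial.C β * Polynomial.X]

/-- The equation of the line `z = α x + β y`. -/
noncomputable def lineForm (α β : ℂ) : MvPolynomial (Fin 3) ℂ :=
  X 2 - (C α * X 0 + C β * X 1)

theorem isHomogeneous_lineForm (α β : ℂ) : (lineForm α β).IsHomogeneous 1 :=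
  (isHomogeneous_X ℂ 2).sub (((isHomogeneous_X ℂ 0).C_mul α).add ((isHomogeneous_X ℂ 1).C_mul β))

theorem lineForm_ne_zero (α β : ℂ) : lineForm α β ≠ 0 := by
  intro h
  have := congrArg (eval ![0, 0, 1]) h
  simp [lineForm] at this

theorem natDegree_line_le (α β : ℂ) (i : Fin 3) :
    ((![1, Polynomial.X, Polynomial.C α + Polynomial.C β * Polynomial.X] :
      Fin 3 → Polynomial ℂ) i).natDegree ≤ 1 := by
  fin_cases i
  · simp
  · simp
  · simp only [Fin.reduceFinMk, Matrix.cons_val]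
    compute_degree

theorem IsHomogeneous.natDegree_lineRestrict_le {n : ℕ} {G : MvPolynomial (Fin 3) ℂ}
    (hG : G.IsHomogeneous n) (α β : ℂ) : (lineRestrict α β G).natDegree ≤ n :=
  (hG.natDegree_aeval_le_and_coeff (natDegree_line_le α β)).1

theorem IsHomogeneous.coeff_lineRestrict {n : ℕ} {G : MvPolynomial (Fin 3) ℂ}
    (hG : G.IsHomogeneous n) (α β : ℂ) :
    (lineRestrict α β G).coeff n = eval ![0, 1, β] G := by
  rw [lineRestrict, (hG.natDegree_aeval_le_and_coeff (natDegree_line_le α β)).2]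
  congr 2
  ext i
  fin_cases i
  · simp [Polynomial.coeff_one]
  · simp
  · simp [Polynomial.coeff_C]

theorem IsHomogeneous.natDegree_lineRestrict {n : ℕ} {G : MvPolynomial (Fin 3) ℂ}
    (hG : G.IsHomogeneous n) {α β : ℂ} (h : eval ![0, 1, β] G ≠ 0) :
    (lineRestrict α β G).natDegree = n :=
  Polynomial.natDegree_eq_of_le_of_coeff_ne_zero (hG.natDegree_lineRestrict_le α β)
    (by rwa [hG.coeff_lineRestrict])

theorem eval_lineRestrict (α β t : ℂ) (G : MvPolynomial (Fin 3) ℂ) :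
    (lineRestrict α β G).eval t = eval ![1, t, α + β * t] G := by
  have : (Polynomial.aeval t).comp (lineRestrict α β) =
      MvPolynomial.aeval ![1, t, α + β * t] := by
    ext i
    fin_cases i <;> simp [lineRestrict]
  have h := DFunLike.congr_fun this G
  simpa [Polynomial.coe_aeval_eq_eval, aeval_eq_eval] using h

theorem exists_lineRestrict_eq (α β : ℂ) {n : ℕ} {p : Polynomial ℂ} (hp : p.natDegree ≤ n) :
    ∃ G : MvPolynomial (Fin 3) ℂ, G.IsHomogeneous n ∧ lineRestrict α β G = p := by
  refine ⟨∑ i ∈ Finset.range (n + 1), C (p.coeff i) * (X 1 ^ i * X 0 ^ (n - i)), ?_, ?_⟩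
  · refine IsHomogeneous.sum _ _ _ fun i hi => ?_
    have hi' : i + (n - i) = n := by
      have := Finset.mem_range.mp hi
      omega
    have := ((isHomogeneous_X_pow (R := ℂ) (1 : Fin 3) i).mul
      (isHomogeneous_X_pow (R := ℂ) (0 : Fin 3) (n - i))).C_mul (p.coeff i)
    rwa [hi'] at this
  · conv_rhs => rw [p.as_sum_range' (n + 1) (by omega)]
    rw [map_sum]
    refine Finset.sum_congr rfl fun i _ => ?_
    simp [lineRestrict, ← Polynomial.C_mul_X_pow_eq_monomial]

theorem IsHomogeneous.exists_eq_lineForm_mul {α β : ℂ} {n : ℕ} {G : MvPolynomial (Fin 3) ℂ}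
    (hG : G.IsHomogeneous (n + 1)) (h : lineRestrict α β G = 0) :
    ∃ G' : MvPolynomial (Fin 3) ℂ, G'.IsHomogeneous n ∧ G = lineForm α β * G' := by
  by_cases hG0 : G = 0
  · exact ⟨0, isHomogeneous_zero _ _ _, by simp [hG0]⟩
  have hdvd : lineForm α β ∣ G := by
    let S := MvPolynomial (Fin 3) ℂ
    let K := FractionRing S
    let x : K := algebraMap S K (X 0)
    let y : K := algebraMap S K (X 1)
    have hx : x ≠ 0 := by
      intro h0
      exact X_ne_zero (R := ℂ) (0 : Fin 3) (IsFractionRing.injective S K (h0.trans (map_zero _).symm))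
    have hyx : x * (y / x) = y := by rw [mul_comm, div_mul_cancel₀ y hx]
    let w : Fin 3 → S := ![X 0, X 1, C α * X 0 + C β * X 1]
    have hw : MvPolynomial.aeval w G = 0 := by
      apply IsFractionRing.injective S K
      rw [map_zero, ← MvPolynomial.aeval_algebraMap_apply]
      have : (fun i => algebraMap S K (w i)) = fun i =>
          x * (Polynomial.aeval (y / x)
            ((![1, Polynomial.X, Polynomial.C α + Polynomial.C β * Polynomial.X] :
              Fin 3 → Polynomial ℂ) i)) := by
        ext i
        fin_cases i
        · simp [w, x]
        · simpa [w] using hyx.symm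
        · simp [w]
          have h1 : ∀ c : ℂ, algebraMap S K (C c) = algebraMap ℂ K c := fun c => by
            rw [IsScalarTower.algebraMap_apply ℂ S K, algebraMap_eq]
          rw [h1, h1]
          change _ * x + _ * y = _
          linear_combination (-algebraMap ℂ K β) * hyx
      have h2 := hG.aeval_mul x (fun i => Polynomial.aeval (y / x)
            ((![1, Polynomial.X, Polynomial.C α + Polynomial.C β * Polynomial.X] :
              Fin 3 → Polynomial ℂ) i))
      have h3 : MvPolynomial.aeval (fun i => Polynomial.aeval (y / x)
            ((![1, Polynomial.X, Polynomial.C α + Polynomial.C β * Polynomial.X] :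
              Fin 3 → Polynomial ℂ) i)) G = Polynomial.aeval (y / x) (lineRestrict α β G) := by
        rw [lineRestrict, ← MvPolynomial.comp_aeval_apply]
      change MvPolynomial.aeval (fun i => algebraMap S K (w i)) G = 0
      rw [this, h2, h3, h, map_zero, mul_zero]
    rw [← Ideal.mem_span_singleton, ← Ideal.Quotient.eq_zero_iff_mem]
    let π := Ideal.Quotient.mkₐ ℂ (Ideal.span {lineForm α β})
    have h1 : π = π.comp (MvPolynomial.aeval w) := by
      ext i
      fin_cases i
      · simp [w]
      · simp [w]
      · simp only [Fin.reduceFinMk, AlgHom.comp_apply, aeval_X]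
        refine (Ideal.Quotient.mk_eq_mk_iff_sub_mem _ _).mpr ?_
        exact Ideal.mem_span_singleton_self _
    change π G = 0
    rw [h1, AlgHom.comp_apply, hw, map_zero]
  obtain ⟨k, m, r, hkm, hk, hr, hGr⟩ := hG.exists_of_dvd hG0 hdvd
  have hk1 := hk.inj_right (isHomogeneous_lineForm α β) (lineForm_ne_zero α β)
  obtain rfl : m = n := by omega
  exact ⟨r, hr, hGr⟩

end MvPolynomial

theorem Polynomial.exists_eq_mul_of_natDegree_eq_add {K : Type*} [Field K] [IsAlgClosed K]
    (m n : ℕ) {f : Polynomial K} (hf : f.natDegree = m + n) :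
    ∃ b q : Polynomial K, f = b * q ∧ b.natDegree = m ∧ q.natDegree = n := by
  induction m generalizing f with
  | zero => exact ⟨1, f, by simp, by simp, by simpa using hf⟩
  | succ m ih =>
    have hdeg : f.degree ≠ 0 := fun h => by
      have := Polynomial.natDegree_eq_zero_iff_degree_le_zero.mpr h.le
      omega
    obtain ⟨r, hr⟩ := IsAlgClosed.exists_root f hdeg
    obtain ⟨g, rfl⟩ := Polynomial.dvd_iff_isRoot.mpr hr
    have hg : g ≠ 0 := by
      rintro rfl
      rw [mul_zero, Polynomial.natDegree_zero] at hf
      omega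
    rw [Polynomial.natDegree_mul (Polynomial.X_sub_C_ne_zero r) hg,
      Polynomial.natDegree_X_sub_C] at hf
    obtain ⟨b, q, rfl, hb, hq⟩ := ih (by omega : g.natDegree = m + n)
    refine ⟨(X - C r) * b, q, by ring, ?_, hq⟩
    rw [Polynomial.natDegree_mul (Polynomial.X_sub_C_ne_zero r) (left_ne_zero_of_mul hg),
      Polynomial.natDegree_X_sub_C, hb, add_comm]

theorem IsCoprime.exists_eq_mul_add_mul_natDegree_le {K : Type*} [Field K] {k l n : ℕ}
    {c d g : Polynomial K} (h : IsCoprime c d) (hc : c ≠ 0) (hck : c.natDegree = k)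
    (hd : d.natDegree ≤ l) (hg : g.natDegree ≤ n) (hkl : k + l ≤ n + 1) (hkn : k ≤ n) :
    ∃ u w : Polynomial K, g = c * u + d * w ∧ u.natDegree ≤ n - k ∧ w.natDegree ≤ n - l := by
  obtain ⟨a, b, hab⟩ := h
  have hmod : c * (g * b / c) + (g * b) % c = g * b := EuclideanDomain.div_add_mod _ _
  set w := (g * b) % c with hw
  set u := g * a + d * (g * b / c)
  have hgu : g = c * u + d * w := by
    linear_combination (-g) * hab - d * hmod
  have hwdeg : w = 0 ∨ w.natDegree + 1 ≤ k := by
    by_cases hk : c.natDegree = 0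
    · left
      have := Polynomial.degree_mod_lt (g * b) hc
      rw [Polynomial.degree_eq_natDegree hc, hk] at this
      exact Polynomial.degree_eq_bot.mp (Nat.WithBot.lt_zero_iff.mp this)
    · right
      have : w.natDegree < c.natDegree := Polynomial.natDegree_mod_lt (g * b) hk
      omega
  refine ⟨u, w, hgu, ?_, ?_⟩
  · by_cases hu : u = 0
    · simp [hu]
    have h1 : (c * u).natDegree ≤ n := by
      rw [show c * u = g - d * w by linear_combination -hgu]
      refine (Polynomial.natDegree_sub_le_of_le hg (?_ : _ ≤ n)).trans (by simp)
      rcases hwdeg with h0 | h0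
      · simp [h0]
      · exact (Polynomial.natDegree_mul_le_of_le hd le_rfl).trans (by omega)
    rw [Polynomial.natDegree_mul hc hu] at h1
    omega
  · rcases hwdeg with h0 | h0
    · simp [h0]
    · omega

namespace MvPolynomial

theorem Smooth.not_mul {F p q : MvPolynomial (Fin 3) ℂ} (hF : Smooth F) {a b : ℕ}
    (hp : p.IsHomogeneous a) (hq : q.IsHomogeneous b) (ha : 1 ≤ a) (hb : 1 ≤ b) :
    F ≠ p * q := by
  rintro rfl
  obtain ⟨P, hP0, hpP, hqP⟩ := exists_common_zero hp hq ha hb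
  exact hP0 (hF P fun i => by simp [hpP, hqP])

theorem Smooth.ne_zero {F : MvPolynomial (Fin 3) ℂ} (hF : Smooth F) : F ≠ 0 := by
  rintro rfl
  have := hF ![1, 0, 0] (by simp)
  simpa using congrFun this 0

theorem Smooth.isRelPrime {n k : ℕ} {F C' D R T : MvPolynomial (Fin 3) ℂ} (hF : Smooth F)
    (hn : F.IsHomogeneous n) (hC : C'.IsHomogeneous k) (hC0 : C' ≠ 0) (hk : k < n)
    (h : F = C' * R - D * T) : IsRelPrime C' D := by
  intro p hpC hpD
  have hpF : p ∣ F := h ▸ (hpC.mul_right R).sub (hpD.mul_right T)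
  obtain ⟨a, b, r, hab, hp, hr, hFr⟩ := hn.exists_of_dvd hF.ne_zero hpF
  obtain ⟨a', b', r', hab', hp', hr', hCr⟩ := hC.exists_of_dvd hC0 hpC
  have hp0 : p ≠ 0 := left_ne_zero_of_mul (hCr ▸ hC0)
  obtain rfl := hp.inj_right hp' hp0
  rcases Nat.eq_zero_or_pos a with rfl | ha
  · exact hp.isUnit_of_zero hp0
  · exact absurd hFr (hF.not_mul hp hr ha (by omega))

theorem Smooth.exists_eval_ne_zero {n : ℕ} {F : MvPolynomial (Fin 3) ℂ} (hF : Smooth F)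
    (hn : F.IsHomogeneous n) (h2 : 2 ≤ n) : ∃ β : ℂ, eval ![0, 1, β] F ≠ 0 := by
  by_contra! hall
  obtain ⟨n, rfl⟩ : ∃ m, n = m + 1 := ⟨n - 1, by omega⟩
  let σ : Equiv.Perm (Fin 3) := Equiv.addRight 2
  have hG : (rename σ F).IsHomogeneous (n + 1) := hn.rename_isHomogeneous
  have h0 : lineRestrict 0 0 (rename σ F) = 0 := by
    refine Polynomial.funext fun t => ?_
    rw [eval_lineRestrict, eval_rename, Polynomial.eval_zero]
    refine Eq.trans ?_ (hall t)
    congr 2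
    ext i
    fin_cases i
    · simp [σ]
    · simp [σ]
    · simp [σ]
  obtain ⟨G', hG', hFG⟩ := hG.exists_eq_lineForm_mul h0
  refine hF.not_mul (isHomogeneous_X ℂ (σ.symm 2)) (hG'.rename_isHomogeneous (f := σ.symm)) le_rfl
    (by omega) ?_
  have := congrArg (rename σ.symm) hFG
  rw [rename_rename, Equiv.symm_comp_self, rename_id_apply, map_mul] at this
  simpa [lineForm] using this

theorem finite_setOf_not_isCoprime_lineRestrict {k l : ℕ} {A B : MvPolynomial (Fin 3) ℂ}
    (hA : A.IsHomogeneous k) (hB : B.IsHomogeneous l) (hA0 : A ≠ 0) (h : IsRelPrime A B) (β : ℂ) :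
    {α | ¬ IsCoprime (lineRestrict α β A) (lineRestrict α β B)}.Finite := by
  refine ((commonZeros_finite hA hB hA0 h).biUnion (t := fun L =>
    {α | ∃ t, ![1, t, α + β * t] ∈ L}) ?_).subset ?_
  · rintro L ⟨v, -, rfl, -, -⟩
    refine (Set.finite_singleton ((v 2 - β * v 1) / v 0)).subset ?_
    rintro α ⟨t, ht⟩
    obtain ⟨c, hc⟩ := Submodule.mem_span_singleton.mp ht
    have h0 : c * v 0 = 1 := by simpa using congrFun hc 0
    have h1 : c * v 1 = t := by simpa using congrFun hc 1
    have h2 : c * v 2 = α + β * t := by simpa using congrFun hc 2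
    have hv : v 0 ≠ 0 := right_ne_zero_of_mul (h0 ▸ one_ne_zero)
    rw [Set.mem_singleton_iff, eq_div_iff hv]
    linear_combination (-(v 0)) * h2 + β * v 0 * h1 - (β * v 1 - v 2) * h0
  · intro α hα
    simp only [Set.mem_ofPred_eq, Polynomial.isCoprime_iff_aeval_ne_zero_of_isAlgClosed ℂ ℂ,
      not_forall, not_or, not_not, Polynomial.coe_aeval_eq_eval, eval_lineRestrict] at hα
    obtain ⟨t, htA, htB⟩ := hα
    refine Set.mem_biUnion (x := Submodule.span ℂ {![1, t, α + β * t]}) ⟨_, ?_, rfl, htA, htB⟩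
      ⟨t, Submodule.mem_span_singleton_self _⟩
    intro h0
    simpa using congrFun h0 0

theorem eval_derivative_lineRestrict (α β t : ℂ) (G : MvPolynomial (Fin 3) ℂ) :
    (Polynomial.derivative (lineRestrict α β G)).eval t =
      eval ![1, t, α + β * t] (pderiv 1 G) + β * eval ![1, t, α + β * t] (pderiv 2 G) := by
  have h := Polynomial.derivative'.apply_aeval_mvPolynomial
    (![1, Polynomial.X, Polynomial.C α + Polynomial.C β * Polynomial.X]) G
  simp only [Fin.sum_univ_three, Polynomial.derivative'_apply, Matrix.cons_val] at h
  simp only [← eval_lineRestrict]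
  have h' : Polynomial.derivative (lineRestrict α β G) =
      lineRestrict α β (pderiv 1 G) + lineRestrict α β (pderiv 2 G) * Polynomial.C β := by
    simpa [lineRestrict] using h
  rw [h']
  simp [mul_comm]

theorem Smooth.finite_setOf_not_separable_lineRestrict {n : ℕ} {F : MvPolynomial (Fin 3) ℂ}
    (hF : Smooth F) (hn : F.IsHomogeneous n) (β : ℂ) :
    {α | ¬ (lineRestrict α β F).Separable}.Finite := by
  refine (finite_setOf_degenerate (X 2 - C β * X 1) (-X 0) F 0).subset ?_
  intro α hα
  simp only [Set.mem_ofPred_eq, Polynomial.Separable,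
    Polynomial.isCoprime_iff_aeval_ne_zero_of_isAlgClosed ℂ ℂ,
    not_forall, not_or, not_not, Polynomial.coe_aeval_eq_eval, eval_lineRestrict,
    eval_derivative_lineRestrict] at hα
  obtain ⟨t, h0, h1⟩ := hα
  have hE := hn.sum_mul_eval_pderiv ![1, t, α + β * t]
  rw [h0, Fin.sum_univ_three] at hE
  simp only [Matrix.cons_val] at hE
  refine ⟨![1, t, α + β * t], -eval ![1, t, α + β * t] (pderiv 2 F), 1, ?_, ?_, ?_, ?_⟩
  · simp
  · simp [h0]
  · intro i
    fin_cases i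
    · simp [pderiv_X]
      linear_combination hE - t * h1
    · simp [pderiv_X]
      linear_combination h1
    · simp [pderiv_X]
  · intro h2
    have h2' : eval ![1, t, α + β * t] (pderiv 2 F) = 0 := by simpa using h2
    have := hF ![1, t, α + β * t] fun i => by
      fin_cases i
      · change eval _ (pderiv 0 F) = 0
        linear_combination hE - t * h1 - α * h2'
      · change eval _ (pderiv 1 F) = 0
        linear_combination h1 - β * h2'
      · exact h2'
    simpa using congrFun this 0

/-- A relation `C a = D b` along a line comes from a relation of forms. -/
theorem exists_lift_of_lineRestrict_eq {α β : ℂ} {k m : ℕ} {C' D a b : MvPolynomial (Fin 3) ℂ}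
    (hC : C'.IsHomogeneous k) (hD : D.IsHomogeneous k) (ha : a.IsHomogeneous (k + m + 1))
    (hb : b.IsHomogeneous (k + m + 1)) (hCβ : eval ![0, 1, β] C' ≠ 0)
    (hcop : IsCoprime (lineRestrict α β C') (lineRestrict α β D))
    (h : lineRestrict α β (C' * a) = lineRestrict α β (D * b)) :
    ∃ Ω W Z : MvPolynomial (Fin 3) ℂ, Ω.IsHomogeneous (m + 1) ∧ W.IsHomogeneous (k + m) ∧
      Z.IsHomogeneous (k + m) ∧ a = D * Ω + lineForm α β * W ∧ b = C' * Ω + lineForm α β * Z := by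
  have hdeg := hC.natDegree_lineRestrict (α := α) hCβ
  have hc0 : lineRestrict α β C' ≠ 0 := by
    intro h0
    apply hCβ
    rw [← hC.coeff_lineRestrict α β, h0, Polynomial.coeff_zero]
  rw [map_mul, map_mul] at h
  obtain ⟨ω, hω⟩ := hcop.dvd_of_dvd_mul_left (Dvd.intro _ h)
  have hωdeg : ω.natDegree ≤ m + 1 := by
    by_cases hω0 : ω = 0
    · simp [hω0]
    have := hb.natDegree_lineRestrict_le α β
    rw [hω, Polynomial.natDegree_mul hc0 hω0, hdeg] at this
    omega
  obtain ⟨Ω, hΩ, rfl⟩ := exists_lineRestrict_eq α β hωdeg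
  have haΩ : lineRestrict α β a = lineRestrict α β D * lineRestrict α β Ω :=
    mul_left_cancel₀ hc0 (by rw [h, hω]; ring)
  obtain ⟨W, hW, hWa⟩ := (ha.sub (hD.mul hΩ)).exists_eq_lineForm_mul
    (by rw [map_sub, map_mul, haΩ, sub_self])
  obtain ⟨Z, hZ, hZb⟩ := (hb.sub (hC.mul hΩ)).exists_eq_lineForm_mul
    (by rw [map_sub, map_mul, hω, sub_self])
  exact ⟨Ω, W, Z, hΩ, hW, hZ, by linear_combination hWa, by linear_combination hZb⟩

/-- A decomposition `F = C R - D T` with `C, D` of degree `k` and `R, T` of degree `l`, at which the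
differential of `(C, D, R, T) ↦ C R - D T` is onto the forms of degree `k + l`. -/
structure IsSubmersiveDecomposition (F : MvPolynomial (Fin 3) ℂ) (k l : ℕ)
    (C' D R T : MvPolynomial (Fin 3) ℂ) : Prop where
  left : C'.IsHomogeneous k
  left' : D.IsHomogeneous k
  right : R.IsHomogeneous l
  right' : T.IsHomogeneous l
  eq : F = C' * R - D * T
  span : ∀ G : MvPolynomial (Fin 3) ℂ, G.IsHomogeneous (k + l) →
    ∃ a b c e : MvPolynomial (Fin 3) ℂ, a.IsHomogeneous l ∧ b.IsHomogeneous l ∧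
      c.IsHomogeneous k ∧ e.IsHomogeneous k ∧ G = C' * a + D * b + R * c + T * e

theorem IsSubmersiveDecomposition.swap {F : MvPolynomial (Fin 3) ℂ} {k l : ℕ}
    {C' D R T : MvPolynomial (Fin 3) ℂ} (h : IsSubmersiveDecomposition F k l C' D R T) :
    IsSubmersiveDecomposition F k l D C' (-T) (-R) where
  left := h.left'
  left' := h.left
  right := h.right'.neg
  right' := h.right.neg
  eq := by rw [h.eq]; ring
  span G hG := by
    obtain ⟨a, b, c, e, ha, hb, hc, he, rfl⟩ := h.span G hG
    exact ⟨b, a, -e, -c, hb, ha, he.neg, hc.neg, by ring⟩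

/-- The differential of `(B, C, D, X, Y, Z, W) ↦ A (C W - D Z) + B (D X - C Y) + t (X W - Y Z)`. -/
noncomputable def detDeriv (A t B C D X Y Z W δB δC δD δX δY δZ δW : MvPolynomial (Fin 3) ℂ) :
    MvPolynomial (Fin 3) ℂ :=
  A * (C * δW + δC * W - D * δZ - δD * Z) + δB * (D * X - C * Y) +
    B * (δD * X + D * δX - δC * Y - C * δY) + t * (δX * W + X * δW - δY * Z - Y * δZ)

theorem IsSubmersiveDecomposition.exists_submersion_of_eval_ne_zero {F : MvPolynomial (Fin 3) ℂ}
    {k m : ℕ} {C' D R T : MvPolynomial (Fin 3) ℂ}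
    (h : IsSubmersiveDecomposition F k (k + m + 1) C' D R T) (hF : Smooth F) {β : ℂ}
    (hCβ : eval ![0, 1, β] C' ≠ 0) (hFβ : eval ![0, 1, β] F ≠ 0) :
    ∃ A B X Y Z W : MvPolynomial (Fin 3) ℂ, A.IsHomogeneous 1 ∧ B.IsHomogeneous m ∧
      X.IsHomogeneous (k + 1) ∧ Y.IsHomogeneous (k + 1) ∧ Z.IsHomogeneous (k + m) ∧
      W.IsHomogeneous (k + m) ∧ F = A * (C' * W - D * Z) + B * (D * X - C' * Y) ∧
      ∀ G : MvPolynomial (Fin 3) ℂ, G.IsHomogeneous (k + (k + m + 1)) →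
        ∃ δB δC δD δX δY δZ δW : MvPolynomial (Fin 3) ℂ, δB.IsHomogeneous m ∧
          δC.IsHomogeneous k ∧ δD.IsHomogeneous k ∧ δX.IsHomogeneous (k + 1) ∧
          δY.IsHomogeneous (k + 1) ∧ δZ.IsHomogeneous (k + m) ∧ δW.IsHomogeneous (k + m) ∧
          G = detDeriv A 0 B C' D X Y Z W δB δC δD δX δY δZ δW := by
  obtain ⟨hC, hD, hR, hT, hFeq, hspan⟩ := h
  have hFhom : F.IsHomogeneous (k + (k + m + 1)) := hFeq ▸ (hC.mul hR).sub (hD.mul hT)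
  have hC0 : C' ≠ 0 := by
    rintro rfl
    simp at hCβ
  have hrel := hF.isRelPrime hFhom hC hC0 (by omega) hFeq
  obtain ⟨α, hα⟩ := ((finite_setOf_not_isCoprime_lineRestrict hC hD hC0 hrel β).union
    (hF.finite_setOf_not_separable_lineRestrict hFhom β)).infinite_compl.nonempty
  simp only [Set.mem_compl_iff, Set.mem_union, Set.mem_ofPred_eq, not_or, not_not] at hα
  obtain ⟨hcop, hsep⟩ := hα
  set φ := lineRestrict α β
  set A := lineForm α β
  have hφC : (φ C').natDegree = k := hC.natDegree_lineRestrict hCβ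
  have hφC0 : φ C' ≠ 0 := by
    intro h0
    apply hCβ
    rw [← hC.coeff_lineRestrict α β]
    change (φ C').coeff k = 0
    rw [h0, Polynomial.coeff_zero]
  have hφD : (φ D).natDegree ≤ k := hD.natDegree_lineRestrict_le α β
  have hsplit : ∀ g : Polynomial ℂ, g.natDegree ≤ 2 * k + 1 →
      ∃ X Y : MvPolynomial (Fin 3) ℂ, X.IsHomogeneous (k + 1) ∧ Y.IsHomogeneous (k + 1) ∧
        g = φ D * φ X - φ C' * φ Y := by
    intro g hg
    obtain ⟨u, w, hguw, hu, hw⟩ := hcop.exists_eq_mul_add_mul_natDegree_le hφC0 hφC hφD hg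
      (by omega) (by omega)
    obtain ⟨X, hX, hXw⟩ := exists_lineRestrict_eq α β (n := k + 1) (p := w) (by omega)
    obtain ⟨Y, hY, hYu⟩ := exists_lineRestrict_eq α β (n := k + 1) (p := -u)
      (by rw [Polynomial.natDegree_neg]; omega)
    refine ⟨X, Y, hX, hY, ?_⟩
    change g = φ D * lineRestrict α β X - φ C' * lineRestrict α β Y
    rw [hXw, hYu, hguw]
    ring
  obtain ⟨b, q, hbq, hb, hq⟩ := Polynomial.exists_eq_mul_of_natDegree_eq_add m (2 * k + 1)
    (f := φ F) (by rw [hFhom.natDegree_lineRestrict hFβ]; ring)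
  have hb0 : b ≠ 0 := by
    rintro rfl
    apply hFβ
    rw [← hFhom.coeff_lineRestrict α β]
    change (φ F).coeff _ = 0
    rw [hbq, zero_mul, Polynomial.coeff_zero]
  have hbqcop : IsCoprime b q := by
    rw [hbq] at hsep
    exact hsep.isCoprime
  obtain ⟨B, hB, rfl⟩ := exists_lineRestrict_eq α β hb.le
  obtain ⟨X, Y, hX, hY, rfl⟩ := hsplit q hq.le
  have hBX : ∀ {B X : MvPolynomial (Fin 3) ℂ}, B.IsHomogeneous m → X.IsHomogeneous (k + 1) →
      (B * X).IsHomogeneous (k + m + 1) := fun h1 h2 => by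
    have := h1.mul h2
    rwa [show m + (k + 1) = k + m + 1 by ring] at this
  obtain ⟨Ω, W, Z, hΩ, hW, hZ, hRΩ, hTΩ⟩ := exists_lift_of_lineRestrict_eq (α := α) hC hD
    (hR.add (hBX hB hY)) (hT.add (hBX hB hX)) hCβ hcop (by
      rw [hFeq] at hbq
      simp only [map_sub, map_mul, map_add] at hbq ⊢
      linear_combination hbq)
  refine ⟨A, B, X, Y, Z, W, isHomogeneous_lineForm α β, hB, hX, hY, hZ, hW, ?_, ?_⟩
  · rw [hFeq]
    linear_combination C' * hRΩ - D * hTΩ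
  · intro G hG
    obtain ⟨a, b, c, e, ha, hb', hc, he, hGeq⟩ := hspan G hG
    have hΩk : ∀ {e : MvPolynomial (Fin 3) ℂ}, e.IsHomogeneous k →
        (Ω * e).IsHomogeneous (k + m + 1) := fun h1 => by
      have := hΩ.mul h1
      rwa [show m + 1 + k = k + m + 1 by ring] at this
    have ha' := ha.add (hΩk he)
    have hb'' := hb'.add (hΩk hc)
    set a' := a + Ω * e
    set b' := b + Ω * c
    obtain ⟨g₁, g₂, hg, hg₁, hg₂⟩ := hbqcop.exists_eq_mul_add_mul_natDegree_le hb0 hb hq.le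
      (((hC.mul ha').add (hD.mul hb'')).natDegree_lineRestrict_le α β) (by omega) (by omega)
    obtain ⟨δX, δY, hδX, hδY, rfl⟩ := hsplit g₁ (by omega)
    obtain ⟨δB, hδB, rfl⟩ := exists_lineRestrict_eq α β (n := m) (p := g₂) (by omega)
    obtain ⟨Ω', δW, δZ, hΩ', hδW, hδZ, h1, h2⟩ := exists_lift_of_lineRestrict_eq (α := α) hC hD
      ((ha'.add (hBX hB hδY)).add (hBX hδB hY)) ((hb''.neg.add (hBX hB hδX)).add (hBX hδB hX))
      hCβ hcop (by
        simp only [map_mul, map_add, map_neg] at hg ⊢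
        linear_combination hg)
    refine ⟨δB, c, -e, δX, δY, δZ, δW, hδB, hc, he.neg, hδX, hδY, hδZ, hδW, ?_⟩
    rw [hGeq, detDeriv]
    linear_combination C' * h1 - D * h2 + c * hRΩ + e * hTΩ

/-- The space of forms of degree `n`. -/
def Form (n : ℕ) : Type := homogeneousSubmodule (Fin 3) ℂ n

namespace Form

variable {n : ℕ}

noncomputable instance : AddCommGroup (Form n) :=
  inferInstanceAs (AddCommGroup (homogeneousSubmodule (Fin 3) ℂ n))

noncomputable instance : Module ℂ (Form n) :=
  inferInstanceAs (Module ℂ (homogeneousSubmodule (Fin 3) ℂ n))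

instance : Module.Finite ℂ (Form n) :=
  inferInstanceAs (Module.Finite ℂ (homogeneousSubmodule (Fin 3) ℂ n))

/-- The polynomial underlying a form. -/
noncomputable def val : Form n →ₗ[ℂ] MvPolynomial (Fin 3) ℂ :=
  (homogeneousSubmodule (Fin 3) ℂ n).subtype

/-- A homogeneous polynomial, as a form. -/
def of {p : MvPolynomial (Fin 3) ℂ} (hp : p.IsHomogeneous n) : Form n :=
  Subtype.mk p ((mem_homogeneousSubmodule n p).mpr hp)

@[simp]
theorem val_of {p : MvPolynomial (Fin 3) ℂ} (hp : p.IsHomogeneous n) : (of hp).val = p :=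
  rfl

theorem isHomogeneous_val (x : Form n) : x.val.IsHomogeneous n :=
  (mem_homogeneousSubmodule n _).mp (Subtype.property x)

theorem val_injective : Function.Injective (val (n := n)) :=
  Subtype.val_injective

theorem val_add (x y : Form n) : (x + y).val = x.val + y.val :=
  map_add val x y

theorem val_sub (x y : Form n) : (x - y).val = x.val - y.val :=
  map_sub val x y

theorem val_smul (c : ℂ) (x : Form n) : (c • x).val = C c * x.val := by
  rw [map_smul, smul_eq_C_mul]

/-- Coordinates on the space of forms of degree `n`. -/
noncomputable def coord (n : ℕ) : Form n ≃ₗ[ℂ] (Fin (Module.finrank ℂ (Form n)) → ℂ) :=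
  LinearEquiv.ofFinrankEq _ _ (by simp)

noncomputable instance : NormedAddCommGroup (Form n) :=
  NormedAddCommGroup.induced _ _ (coord n) (coord n).injective

noncomputable instance : NormedSpace ℂ (Form n) :=
  NormedSpace.induced ℂ _ _ (coord n)

instance : CompleteSpace (Form n) :=
  FiniteDimensional.complete ℂ _

/-- Multiplication of forms, as a continuous bilinear map. -/
noncomputable def mul {a b c : ℕ} (h : a + b = c) : Form a →L[ℂ] Form b →L[ℂ] Form c :=
  LinearMap.toContinuousBilinearMap <| LinearMap.mk₂ ℂ
    (fun x y => of (h ▸ x.isHomogeneous_val.mul y.isHomogeneous_val))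
    (fun _ _ _ => val_injective (by simp [add_mul])) (fun _ _ _ => val_injective (by simp))
    (fun _ _ _ => val_injective (by simp [mul_add])) (fun _ _ _ => val_injective (by simp))

@[simp]
theorem val_mul {a b c : ℕ} (h : a + b = c) (x : Form a) (y : Form b) :
    (mul h x y).val = x.val * y.val :=
  rfl

end Form

theorem hasDerivAt_add_smul_cubic {E : Type*} [NormedAddCommGroup E] [NormedSpace ℂ E]
    (p₀ p₁ p₂ p₃ : E) :
    HasDerivAt (fun s : ℂ => p₀ + s • p₁ + s ^ 2 • p₂ + s ^ 3 • p₃) p₁ 0 := by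
  have hs := hasDerivAt_id (0 : ℂ)
  convert (((hs.smul_const p₁).const_add p₀).add ((hs.pow 2).smul_const p₂)).add
    ((hs.pow 3).smul_const p₃) using 1
  · rfl
  · simp

/-- The forms `B, C, D, X, Y, Z, W` entering the deformation. -/
abbrev FormData (k m : ℕ) : Type :=
  Form m × Form k × Form k × Form (k + 1) × Form (k + 1) × Form (k + m) × Form (k + m)

theorem exists_ne_zero_and_deform {k m : ℕ} {A B C' D X Y Z W : MvPolynomial (Fin 3) ℂ}
    (hA : A.IsHomogeneous 1) (hB : B.IsHomogeneous m) (hC : C'.IsHomogeneous k)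
    (hD : D.IsHomogeneous k) (hX : X.IsHomogeneous (k + 1)) (hY : Y.IsHomogeneous (k + 1))
    (hZ : Z.IsHomogeneous (k + m)) (hW : W.IsHomogeneous (k + m))
    (hsurj : ∀ G : MvPolynomial (Fin 3) ℂ, G.IsHomogeneous (k + (k + m + 1)) →
      ∃ δB δC δD δX δY δZ δW : MvPolynomial (Fin 3) ℂ, δB.IsHomogeneous m ∧
        δC.IsHomogeneous k ∧ δD.IsHomogeneous k ∧ δX.IsHomogeneous (k + 1) ∧
        δY.IsHomogeneous (k + 1) ∧ δZ.IsHomogeneous (k + m) ∧ δW.IsHomogeneous (k + m) ∧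
        G = detDeriv A 0 B C' D X Y Z W δB δC δD δX δY δZ δW) :
    ∃ (t : ℂ) (B' C'' D' X' Y' Z' W' : MvPolynomial (Fin 3) ℂ), t ≠ 0 ∧
      B'.IsHomogeneous m ∧ C''.IsHomogeneous k ∧ D'.IsHomogeneous k ∧
      X'.IsHomogeneous (k + 1) ∧ Y'.IsHomogeneous (k + 1) ∧ Z'.IsHomogeneous (k + m) ∧
      W'.IsHomogeneous (k + m) ∧
      A * (C'' * W' - D' * Z') + B' * (D' * X' - C'' * Y') + C t * (X' * W' - Y' * Z') =
        A * (C' * W - D * Z) + B * (D * X - C' * Y) ∧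
      ∀ G : MvPolynomial (Fin 3) ℂ, G.IsHomogeneous (k + (k + m + 1)) →
        ∃ δB δC δD δX δY δZ δW : MvPolynomial (Fin 3) ℂ, δB.IsHomogeneous m ∧
          δC.IsHomogeneous k ∧ δD.IsHomogeneous k ∧ δX.IsHomogeneous (k + 1) ∧
          δY.IsHomogeneous (k + 1) ∧ δZ.IsHomogeneous (k + m) ∧ δW.IsHomogeneous (k + m) ∧
          G = detDeriv A (C t) B' C'' D' X' Y' Z' W' δB δC δD δX δY δZ δW := by
  let a : Form 1 := Form.of hA
  have n₁ : k + (k + m) = 2 * k + m := by ring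
  have n₂ : 1 + (2 * k + m) = k + (k + m + 1) := by ring
  have n₃ : k + (k + 1) = 2 * k + 1 := by ring
  have n₄ : m + (2 * k + 1) = k + (k + m + 1) := by ring
  have n₅ : k + 1 + (k + m) = k + (k + m + 1) := by ring
  let Φ : ℂ × FormData k m → Form (k + (k + m + 1)) := fun ⟨t, B, C, D, X, Y, Z, W⟩ =>
    Form.mul n₂ a (Form.mul n₁ C W - Form.mul n₁ D Z) +
      Form.mul n₄ B (Form.mul n₃ D X - Form.mul n₃ C Y) +
      t • (Form.mul n₅ X W - Form.mul n₅ Y Z)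
  let L : ℂ → FormData k m → FormData k m → Form (k + (k + m + 1)) :=
    fun t ⟨B, C, D, X, Y, Z, W⟩ ⟨δB, δC, δD, δX, δY, δZ, δW⟩ =>
    Form.mul n₂ a (Form.mul n₁ C δW + Form.mul n₁ δC W - Form.mul n₁ D δZ - Form.mul n₁ δD Z) +
      Form.mul n₄ δB (Form.mul n₃ D X - Form.mul n₃ C Y) +
      Form.mul n₄ B (Form.mul n₃ δD X + Form.mul n₃ D δX - Form.mul n₃ δC Y - Form.mul n₃ C δY) +
      t • (Form.mul n₅ δX W + Form.mul n₅ X δW - Form.mul n₅ δY Z - Form.mul n₅ Y δZ)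
  have hΦ : ContDiff ℂ 1 Φ := by
    change ContDiff ℂ 1 fun x : ℂ × FormData k m =>
      Form.mul n₂ a (Form.mul n₁ x.2.2.1 x.2.2.2.2.2.2.2 - Form.mul n₁ x.2.2.2.1 x.2.2.2.2.2.2.1) +
      Form.mul n₄ x.2.1 (Form.mul n₃ x.2.2.2.1 x.2.2.2.2.1 - Form.mul n₃ x.2.2.1 x.2.2.2.2.2.1) +
      x.1 • (Form.mul n₅ x.2.2.2.2.1 x.2.2.2.2.2.2.2 - Form.mul n₅ x.2.2.2.2.2.1 x.2.2.2.2.2.2.1)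
    fun_prop
  have hL : ∀ t v δ, HasDerivAt (fun s : ℂ => Φ (t, v + s • δ)) (L t v δ) 0 := by
    rintro t ⟨B, C, D, X, Y, Z, W⟩ ⟨δB, δC, δD, δX, δY, δZ, δW⟩
    have hexp : (fun s : ℂ => Φ (t, (B, C, D, X, Y, Z, W) + s • (δB, δC, δD, δX, δY, δZ, δW))) =
        fun s => Φ (t, B, C, D, X, Y, Z, W) +
          s • L t (B, C, D, X, Y, Z, W) (δB, δC, δD, δX, δY, δZ, δW) +
          s ^ 2 • (Form.mul n₂ a (Form.mul n₁ δC δW - Form.mul n₁ δD δZ) +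
            Form.mul n₄ δB
              (Form.mul n₃ δD X + Form.mul n₃ D δX - Form.mul n₃ δC Y - Form.mul n₃ C δY) +
            Form.mul n₄ B (Form.mul n₃ δD δX - Form.mul n₃ δC δY) +
            t • (Form.mul n₅ δX δW - Form.mul n₅ δY δZ)) +
          s ^ 3 • Form.mul n₄ δB (Form.mul n₃ δD δX - Form.mul n₃ δC δY) := by
      funext s
      apply Form.val_injective
      simp only [Φ, L, Prod.smul_mk, Prod.mk_add_mk, Form.val_add, Form.val_sub,
        Form.val_smul, Form.val_mul, map_pow]
      ring
    rw [hexp]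
    exact hasDerivAt_add_smul_cubic _ _ _ _
  have hLdet : ∀ (t : ℂ) (B : Form m) (C' D : Form k) (X Y : Form (k + 1)) (Z W : Form (k + m))
      (δB : Form m) (δC δD : Form k) (δX δY : Form (k + 1)) (δZ δW : Form (k + m)),
      (L t (B, C', D, X, Y, Z, W) (δB, δC, δD, δX, δY, δZ, δW)).val =
        detDeriv A (C t) B.val C'.val D.val X.val Y.val Z.val W.val
          δB.val δC.val δD.val δX.val δY.val δZ.val δW.val := by
    intros
    simp only [L, detDeriv, Form.val_add, Form.val_sub, Form.val_smul, Form.val_mul,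
      Form.val_of, a]
  obtain ⟨t, ht, ⟨B', C'', D', X', Y', Z', W'⟩, hΦeq, hLsurj⟩ :=
    exists_ne_zero_and_surjective_of_contDiff hΦ
      (v₀ := (.of hB, .of hC, .of hD, .of hX, .of hY, .of hZ, .of hW)) hL (by
        intro G
        obtain ⟨δB, δC, δD, δX, δY, δZ, δW, h1, h2, h3, h4, h5, h6, h7, hδ⟩ :=
          hsurj G.val G.isHomogeneous_val
        refine ⟨(.of h1, .of h2, .of h3, .of h4, .of h5, .of h6, .of h7), ?_⟩
        apply Form.val_injective
        rw [hLdet, C_0, hδ]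
        rfl)
  refine ⟨t, B'.val, C''.val, D'.val, X'.val, Y'.val, Z'.val, W'.val, ht, B'.isHomogeneous_val,
    C''.isHomogeneous_val, D'.isHomogeneous_val, X'.isHomogeneous_val, Y'.isHomogeneous_val,
    Z'.isHomogeneous_val, W'.isHomogeneous_val, ?_, ?_⟩
  · have := congrArg Form.val hΦeq
    simpa only [Φ, a, Form.val_add, Form.val_sub, Form.val_smul, Form.val_mul, Form.val_of, C_0,
      zero_mul, add_zero] using this
  · intro G hG
    obtain ⟨⟨δB, δC, δD, δX, δY, δZ, δW⟩, hδ⟩ := hLsurj (.of hG)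
    refine ⟨δB.val, δC.val, δD.val, δX.val, δY.val, δZ.val, δW.val, δB.isHomogeneous_val,
      δC.isHomogeneous_val, δD.isHomogeneous_val, δX.isHomogeneous_val, δY.isHomogeneous_val,
      δZ.isHomogeneous_val, δW.isHomogeneous_val, ?_⟩
    rw [← hLdet, hδ, Form.val_of]

theorem IsSubmersiveDecomposition.exists_succ {F : MvPolynomial (Fin 3) ℂ}
    {k m : ℕ} {C' D R T : MvPolynomial (Fin 3) ℂ}
    (h : IsSubmersiveDecomposition F k (k + m + 1) C' D R T) (hF : Smooth F) (hm : 1 ≤ m) :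
    ∃ C'' D' R' T' : MvPolynomial (Fin 3) ℂ,
      IsSubmersiveDecomposition F (k + 1) (k + m) C'' D' R' T' := by
  have hFhom : F.IsHomogeneous (k + (k + m + 1)) :=
    h.eq ▸ (h.left.mul h.right).sub (h.left'.mul h.right')
  obtain ⟨β, hβ⟩ := hF.exists_eval_ne_zero hFhom (by omega)
  wlog hCβ : eval ![0, 1, β] C' ≠ 0 generalizing C' D R T
  · refine this h.swap fun hDβ => hβ ?_
    rw [h.eq]
    simp [not_not.mp hCβ, hDβ]
  obtain ⟨A, B, X, Y, Z, W, hA, hB, hX, hY, hZ, hW, hFeq, hsurj⟩ :=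
    h.exists_submersion_of_eval_ne_zero hF hCβ hβ
  obtain ⟨t, B', C'', D', X', Y', Z', W', ht, hB', hC', hD', hX', hY', hZ', hW', heq, hspan⟩ :=
    exists_ne_zero_and_deform hA hB h.left h.left' hX hY hZ hW hsurj
  have hAC : ∀ {P Q : MvPolynomial (Fin 3) ℂ}, P.IsHomogeneous k → Q.IsHomogeneous (k + 1) →
      (A * P + C t * Q).IsHomogeneous (k + 1) := fun hP hQ => by
    have := hA.mul hP
    rw [add_comm] at this
    exact this.add (hQ.C_mul t)
  have hBC : ∀ {P Q : MvPolynomial (Fin 3) ℂ}, P.IsHomogeneous m → Q.IsHomogeneous k →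
      (P * Q).IsHomogeneous (k + m) := fun hP hQ => by
    rw [add_comm]
    exact hP.mul hQ
  have hinv : (C t⁻¹ * C t : MvPolynomial (Fin 3) ℂ) = 1 := by
    rw [← C_mul, inv_mul_cancel₀ ht, C_1]
  refine ⟨A * C'' + C t * X', A * D' + C t * Y', C t⁻¹ * (B' * D' + C t * W'),
    C t⁻¹ * (B' * C'' + C t * Z'), hAC hC' hX', hAC hD' hY',
    ((hBC hB' hD').add (hW'.C_mul t)).C_mul _, ((hBC hB' hC').add (hZ'.C_mul t)).C_mul _, ?_, ?_⟩
  · rw [hFeq, ← heq]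
    linear_combination (-(A * (C'' * W' - D' * Z') + B' * (D' * X' - C'' * Y') +
      C t * (X' * W' - Y' * Z'))) * hinv
  · intro G hG
    rw [show k + 1 + (k + m) = k + (k + m + 1) by ring] at hG
    obtain ⟨δB, δC, δD, δX, δY, δZ, δW, h1, h2, h3, h4, h5, h6, h7, rfl⟩ := hspan G hG
    refine ⟨C t⁻¹ * (δB * D' + B' * δD + C t * δW), -(C t⁻¹ * (δB * C'' + B' * δC + C t * δZ)),
      A * δC + C t * δX, -(A * δD + C t * δY),
      (((hBC h1 hD').add (hBC hB' h3)).add (h7.C_mul t)).C_mul _,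
      ((((hBC h1 hC').add (hBC hB' h2)).add (h6.C_mul t)).C_mul _).neg,
      hAC h2 h4, (hAC h3 h5).neg, ?_⟩
    rw [detDeriv]
    linear_combination (-(A * (C'' * δW + δC * W' - D' * δZ - δD * Z') +
      δB * (D' * X' - C'' * Y') + B' * (δD * X' + D' * δX - δC * Y' - C'' * δY) +
      C t * (δX * W' + X' * δW - δY * Z' - Y' * δZ))) * hinv

theorem Smooth.exists_isSubmersiveDecomposition {F : MvPolynomial (Fin 3) ℂ} {d : ℕ}
    (hF : Smooth F) (hn : F.IsHomogeneous (2 * d)) {k : ℕ} (hk : k ≤ d) :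
    ∃ C' D R T : MvPolynomial (Fin 3) ℂ, IsSubmersiveDecomposition F k (2 * d - k) C' D R T := by
  induction k with
  | zero =>
    refine ⟨1, 0, F, 0, isHomogeneous_one _ _, isHomogeneous_zero _ _ _, hn,
      isHomogeneous_zero _ _ _, by ring, fun G hG => ⟨G, 0, 0, 0, ?_, isHomogeneous_zero _ _ _,
        isHomogeneous_zero _ _ _, isHomogeneous_zero _ _ _, by ring⟩⟩
    rwa [zero_add] at hG
  | succ k ih =>
    obtain ⟨C', D, R, T, h⟩ := ih (by omega)
    obtain ⟨m, hm⟩ : ∃ m, 2 * d = k + (k + m + 1) := ⟨2 * d - 2 * k - 1, by omega⟩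
    rw [hm, Nat.add_sub_cancel_left] at h
    rw [show 2 * d - (k + 1) = k + m by omega]
    exact h.exists_succ hF (by omega)

end MvPolynomial

theorem stmt_4 (d : ℕ) (hd : 1 ≤ d) (F : MvPolynomial (Fin 3) ℂ)
    (hF : F.IsHomogeneous (2 * d))
    (hsmooth : ∀ P : Fin 3 → ℂ, (∀ i, eval P (pderiv i F) = 0) → P = 0) :
    ∃ F₁ G₁ F₂ G₂ : MvPolynomial (Fin 3) ℂ,
      F₁.IsHomogeneous d ∧ G₁.IsHomogeneous d ∧ F₂.IsHomogeneous d ∧ G₂.IsHomogeneous d ∧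
      F = F₁ * G₁ + F₂ * G₂ ∧
      (∀ P : Fin 3 → ℂ, (∀ i, eval P (pderiv i F₁) = 0) → P = 0) ∧
      ({L : Submodule ℂ (Fin 3 → ℂ) | ∃ v : Fin 3 → ℂ, v ≠ 0 ∧
          L = Submodule.span ℂ {v} ∧ eval v F₂ = 0 ∧ eval v G₂ = 0}).Finite ∧
      ({L : Submodule ℂ (Fin 3 → ℂ) | ∃ v : Fin 3 → ℂ, v ≠ 0 ∧
          L = Submodule.span ℂ {v} ∧ eval v F₂ = 0 ∧ eval v G₂ = 0}).ncard = d ^ 2 ∧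
      (∀ P : Fin 3 → ℂ, P ≠ 0 → eval P F₂ = 0 → eval P G₂ = 0 →
        LinearIndependent ℂ
          ![fun i => eval P (pderiv i F₂), fun i => eval P (pderiv i G₂)]) := by
  obtain ⟨C', D, R, T, h⟩ := Smooth.exists_isSubmersiveDecomposition hsmooth hF le_rfl
  rw [show 2 * d - d = d by omega] at h
  obtain ⟨F₁, G₁, F₂, G₂, hF₁, hG₁, hF₂, hG₂, hFeq, hF₁s, htrans⟩ :=
    exists_general_position hd hsmooth h.left h.left' h.right'.neg h.right
      (show F = C' * R + D * -T by rw [h.eq]; ring)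
  obtain ⟨hfin, hcard⟩ := htrans.ncard_commonZeros hF₂ hG₂ hd hd
  exact ⟨F₁, G₁, F₂, G₂, hF₁, hG₁, hF₂, hG₂, hFeq, hF₁s, hfin, by rw [sq]; exact hcard, htrans⟩
end

section
/- Let s ≥ 1 and let l₁, m₁, …, l_s, m_s be homogeneous polynomials of degree 1 in ℂ[x₀,…,x_n], and set Q = Σ_{i=1}^{s} lᵢmᵢ. Then there exists a 2^s × 2^s matrix A with entries in ℂ[x₀,…,x_n], each entry homogeneous of degree 1, such that A² = Q · Id, where Id is the 2^s × 2^s identity matrix. -/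
open MvPolynomial

/-- A sum of `s` products of elements of an additive subgroup `S` of a commutative ring has a
square root of size `2 ^ s` with entries in `S`. -/
theorem Matrix.exists_mul_self_eq_sum_mul_smul_one {R : Type*} [CommRing R] (S : AddSubgroup R)
    (s : ℕ) (l m : Fin s → R) (hl : ∀ i, l i ∈ S) (hm : ∀ i, m i ∈ S) :
    ∃ A : Matrix (Fin (2 ^ s)) (Fin (2 ^ s)) R,
      (∀ i j, A i j ∈ S) ∧ A * A = (∑ i, l i * m i) • (1 : Matrix _ _ R) := by
  induction s with
  | zero => exact ⟨0, fun _ _ => S.zero_mem, by simp⟩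
  | succ s ih =>
    obtain ⟨A, hA, hAA⟩ := ih (fun i => l i.succ) (fun i => m i.succ)
      (fun i => hl _) (fun i => hm _)
    let e : Fin (2 ^ s) ⊕ Fin (2 ^ s) ≃ Fin (2 ^ (s + 1)) :=
      finSumFinEquiv.trans (finCongr (by ring))
    let B := Matrix.fromBlocks A (l 0 • 1) (m 0 • 1) (-A)
    have hsmul : ∀ c ∈ S, ∀ i j, (c • (1 : Matrix (Fin (2 ^ s)) (Fin (2 ^ s)) R)) i j ∈ S := by
      intro c hc i j
      by_cases h : i = j <;> simp [h, hc, S.zero_mem]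
    have hB : ∀ i j, B i j ∈ S := by
      rintro (i | i) (j | j)
      · exact hA i j
      · exact hsmul _ (hl 0) i j
      · exact hsmul _ (hm 0) i j
      · exact S.neg_mem (hA i j)
    have hBB : B * B = (∑ i, l i * m i) • (1 : Matrix _ _ R) := by
      rw [Matrix.fromBlocks_multiply, ← Matrix.fromBlocks_one, Matrix.fromBlocks_smul,
        Fin.sum_univ_succ]
      congr 1 <;> simp [hAA, add_smul, smul_smul, mul_comm, add_comm]
    refine ⟨B.submatrix e.symm e.symm, fun i j => hB _ _, ?_⟩
    rw [Matrix.submatrix_mul_equiv, hBB, Matrix.submatrix_smul, Pi.smul_apply, Pi.smul_apply,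
      Matrix.submatrix_one_equiv]

theorem stmt_5 (n s : ℕ) (hs : 1 ≤ s)
    (l m : Fin s → MvPolynomial (Fin (n + 1)) ℂ)
    (hl : ∀ i, (l i).IsHomogeneous 1) (hm : ∀ i, (m i).IsHomogeneous 1) :
    ∃ A : Matrix (Fin (2 ^ s)) (Fin (2 ^ s)) (MvPolynomial (Fin (n + 1)) ℂ),
      (∀ i j, (A i j).IsHomogeneous 1) ∧
      A * A = (∑ i, l i * m i) •
        (1 : Matrix (Fin (2 ^ s)) (Fin (2 ^ s)) (MvPolynomial (Fin (n + 1)) ℂ)) :=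
  Matrix.exists_mul_self_eq_sum_mul_smul_one
    (homogeneousSubmodule (Fin (n + 1)) ℂ 1).toAddSubgroup s l m hl hm
end

section
/- Every homogeneous polynomial Q of degree 2 in ℂ[x₀,…,x_n] can be written as Q = Σ_{i=1}^{s} lᵢmᵢ, where s = ⌊n/2⌋ + 1 and each lᵢ, mᵢ ∈ ℂ[x₀,…,x_n] is homogeneous of degree 1. -/
open MvPolynomial

/-- Every linear functional on `σ → R` is evaluation of a linear form. -/
lemma exists_isHomogeneous_one_eval_eq {σ R : Type*} [Fintype σ] [DecidableEq σ] [CommSemiring R]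
    (f : (σ → R) →ₗ[R] R) :
    ∃ p : MvPolynomial σ R, p.IsHomogeneous 1 ∧ ∀ v, eval v p = f v := by
  refine ⟨∑ j, C (f (Pi.single j 1)) * X j,
    IsHomogeneous.sum _ _ _ fun j _ ↦ isHomogeneous_C_mul_X _ _, fun v ↦ ?_⟩
  conv_rhs => rw [pi_eq_sum_univ' v]
  simp [mul_comm]

/-- A homogeneous polynomial of degree two evaluates as a quadratic form. -/
lemma MvPolynomial.IsHomogeneous.exists_quadraticForm_eval_eq {σ R : Type*} [CommRing R]
    {Q : MvPolynomial σ R} (hQ : Q.IsHomogeneous 2) :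
    ∃ q : QuadraticForm R (σ → R), ∀ v, q v = eval v Q := by
  rw [← mem_homogeneousSubmodule, ← homogeneousSubmodule_one_pow,
    homogeneousSubmodule_one_eq_span_X, sq, Submodule.span_mul_span] at hQ
  induction hQ using Submodule.span_induction with
  | mem x hx =>
    obtain ⟨_, ⟨i, rfl⟩, _, ⟨j, rfl⟩, rfl⟩ := hx
    exact ⟨QuadraticMap.proj i j, fun v ↦ by simp⟩
  | zero => exact ⟨0, fun v ↦ by simp⟩
  | add x y _ _ hx hy =>
    obtain ⟨p, hp⟩ := hx
    obtain ⟨q, hq⟩ := hy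
    exact ⟨p + q, fun v ↦ by simp [hp, hq]⟩
  | smul a x _ hx =>
    obtain ⟨q, hq⟩ := hx
    exact ⟨a • q, fun v ↦ by simp [hq]⟩

/-- Over an algebraically closed field of characteristic not two, a homogeneous polynomial of
degree two is a sum of as many squares of linear forms as there are variables. -/
lemma MvPolynomial.IsHomogeneous.exists_eq_sum_sq {K : Type*} [Field K] [IsAlgClosed K]
    [Invertible (2 : K)] {k : ℕ} {Q : MvPolynomial (Fin k) K} (hQ : Q.IsHomogeneous 2) :
    ∃ L : Fin k → MvPolynomial (Fin k) K, (∀ i, (L i).IsHomogeneous 1) ∧ Q = ∑ i, L i ^ 2 := by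
  obtain ⟨q, hq⟩ := hQ.exists_quadraticForm_eval_eq
  have h := q.equivalent_weightedSumSquares
  rw [Module.finrank_fin_fun] at h
  obtain ⟨w, ⟨e⟩⟩ := h
  choose r hr using fun i ↦ IsAlgClosed.exists_pow_nat_eq (w i) two_pos
  choose L hL hLe using fun i ↦ exists_isHomogeneous_one_eval_eq
    (r i • (LinearMap.proj i ∘ₗ e.toLinearEquiv.toLinearMap))
  refine ⟨L, hL, MvPolynomial.funext fun v ↦ ?_⟩
  rw [← hq, ← e.map_app]
  simp only [QuadraticMap.weightedSumSquares_apply, map_sum, map_pow, hLe]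
  refine Finset.sum_congr rfl fun i _ ↦ ?_
  simp [mul_pow, hr, sq (e v i)]

lemma Finset.sum_range_two_mul {M : Type*} [AddCommMonoid M] (f : ℕ → M) (k : ℕ) :
    ∑ i ∈ range (2 * k), f i = ∑ i ∈ range k, (f (2 * i) + f (2 * i + 1)) := by
  induction k with
  | zero => simp
  | succ k ih => rw [mul_add_one, sum_range_succ, sum_range_succ, ih, sum_range_succ, add_assoc]

theorem stmt_6 (n : ℕ) (Q : MvPolynomial (Fin (n + 1)) ℂ) (hQ : Q.IsHomogeneous 2) :
    ∃ l m : Fin (n / 2 + 1) → MvPolynomial (Fin (n + 1)) ℂ,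
      (∀ i, (l i).IsHomogeneous 1) ∧ (∀ i, (m i).IsHomogeneous 1) ∧
      Q = ∑ i, l i * m i := by
  obtain ⟨L, hL, rfl⟩ := hQ.exists_eq_sum_sq
  let F : ℕ → MvPolynomial (Fin (n + 1)) ℂ := fun i ↦ if h : i < n + 1 then L ⟨i, h⟩ else 0
  have hF (i : ℕ) : (F i).IsHomogeneous 1 := by
    unfold F
    split_ifs
    exacts [hL _, isHomogeneous_zero _ _ _]
  have hsum : ∑ i, L i ^ 2 = ∑ i ∈ Finset.range (2 * (n / 2 + 1)), F i ^ 2 := by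
    rw [← Finset.sum_subset (Finset.range_mono (by lia : n + 1 ≤ 2 * (n / 2 + 1))),
      ← Fin.sum_univ_eq_sum_range]
    · simp only [F, Fin.is_lt, dif_pos, Fin.eta]
    · intro i _ hi
      simp_all [F]
  have hI : (C Complex.I : MvPolynomial (Fin (n + 1)) ℂ) ^ 2 = -1 := by
    rw [← C_pow, Complex.I_sq, C_neg, C_1]
  have hCF (i : ℕ) : (C Complex.I * F i).IsHomogeneous 1 := (hF i).C_mul _
  refine ⟨fun i ↦ F (2 * i) + C Complex.I * F (2 * i + 1),
    fun i ↦ F (2 * i) - C Complex.I * F (2 * i + 1),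
    fun i ↦ (hF _).add (hCF _), fun i ↦ (hF _).sub (hCF _), ?_⟩
  rw [hsum, Finset.sum_range_two_mul, ← Fin.sum_univ_eq_sum_range
    (fun i ↦ F (2 * i) ^ 2 + F (2 * i + 1) ^ 2)]
  refine Finset.sum_congr rfl fun i _ ↦ ?_
  linear_combination F (2 * i + 1) ^ 2 * hI
end

section
/- Let n ≥ 1, d ≥ 1 and set N = C(n+d, n) − 1, the binomial coefficient of (n+d) choose n minus one. Then every homogeneous polynomial F of degree 2d in ℂ[x₀,…,x_n] can be written as F = Σ_{i=1}^{s} FᵢGᵢ with s = ⌊N/2⌋ + 1, where each Fᵢ, Gᵢ ∈ ℂ[x₀,…,x_n] is homogeneous of degree d. -/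
open MvPolynomial

/-- The quadratic form `c ↦ ∑ i j, a (i, j) * c i * c j`, evaluated at polynomials `u`, is a sum of
squares of `card ι` linear combinations of the `u i`. -/
theorem exists_sum_sq_eq_quadratic_expression {σ ι K : Type*} [Field K] [IsAlgClosed K]
    [Invertible (2 : K)] [Fintype ι] (u : ι → MvPolynomial σ K) (a : ι × ι → K) :
    ∃ g : Fin (Fintype.card ι) → MvPolynomial σ K,
      (∀ k, g k ∈ Submodule.span K (Set.range u)) ∧
      ∑ p, a p • (u p.1 * u p.2) = ∑ k, g k ^ 2 := by
  classical
  let Q : QuadraticForm K (ι → K) := ∑ p : ι × ι, a p • QuadraticMap.proj p.1 p.2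
  have hQ (c : ι → K) : Q c = ∑ p : ι × ι, a p * (c p.1 * c p.2) := by
    simp [Q]
  obtain ⟨w, ⟨e⟩⟩ := Q.equivalent_weightedSumSquares
  choose r hr using fun k => IsAlgClosed.exists_pow_nat_eq (w k) two_pos
  let g (k : Fin (Module.finrank K (ι → K))) : MvPolynomial σ K :=
    ∑ i, (r k * e (Pi.single i 1) k) • u i
  have heval (x : σ → K) (k) : eval x (g k) = r k * e (fun i => eval x (u i)) k := by
    have hlin : e (fun i => eval x (u i)) = ∑ i, eval x (u i) • e (Pi.single i 1) := by
      conv_lhs => rw [pi_eq_sum_univ' (fun i => eval x (u i))]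
      change e.toLinearEquiv _ = _
      rw [map_sum]
      simp_rw [map_smul]
      refine Finset.sum_congr rfl fun i _ => ?_
      congr 2
    simp only [g, hlin, map_sum, smul_eval, Finset.sum_apply, Pi.smul_apply, smul_eq_mul,
      Finset.mul_sum]
    exact Finset.sum_congr rfl fun i _ => by ring
  refine ⟨fun k => g (finCongr (Module.finrank_fintype_fun_eq_card K).symm k), fun k => ?_, ?_⟩
  · exact Submodule.sum_mem _ fun i _ =>
      Submodule.smul_mem _ _ (Submodule.subset_span (Set.mem_range_self i))
  · beta_reduce
    rw [Equiv.sum_comp (finCongr (Module.finrank_fintype_fun_eq_card K).symm) fun k => g k ^ 2]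
    refine MvPolynomial.funext fun x => ?_
    have h := e.map_app fun i => eval x (u i)
    rw [hQ, QuadraticMap.weightedSumSquares_apply] at h
    simp only [map_sum, smul_eval, map_mul, map_pow, heval]
    rw [← h]
    exact Finset.sum_congr rfl fun k _ => by rw [← hr, smul_eq_mul]; ring

/-- If `-1` is a square, a sum of `m ≤ 2 * s` squares is a sum of `s` products. -/
theorem exists_sum_mul_eq_sum_sq {A S : Type*} [CommRing A] [SetLike S A] [AddSubgroupClass S A]
    (V : S) {ε : A} (hε : ε ^ 2 = -1) (hV : ∀ v ∈ V, ε * v ∈ V) {m s : ℕ} (hms : m ≤ 2 * s)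
    (g : Fin m → A) (hg : ∀ k, g k ∈ V) :
    ∃ f h : Fin s → A, (∀ i, f i ∈ V) ∧ (∀ i, h i ∈ V) ∧ ∑ k, g k ^ 2 = ∑ i, f i * h i := by
  let g' (k : ℕ) : A := if hk : k < m then g ⟨k, hk⟩ else 0
  have hg' (k) : g' k ∈ V := by
    by_cases hk : k < m
    · simpa [g', hk] using hg _
    · simp [g', hk, zero_mem]
  refine ⟨fun i => g' (2 * i) + ε * g' (2 * i + 1), fun i => g' (2 * i) - ε * g' (2 * i + 1),
    fun i => add_mem (hg' _) (hV _ (hg' _)), fun i => sub_mem (hg' _) (hV _ (hg' _)), ?_⟩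
  have hpair (t : ℕ) : ∑ k ∈ Finset.range (2 * t), g' k ^ 2 =
      ∑ i ∈ Finset.range t,
        (g' (2 * i) + ε * g' (2 * i + 1)) * (g' (2 * i) - ε * g' (2 * i + 1)) := by
    induction t with
    | zero => simp
    | succ t ih =>
      rw [Nat.mul_succ, Finset.sum_range_succ, Finset.sum_range_succ, ih, Finset.sum_range_succ]
      linear_combination g' (2 * t + 1) ^ 2 * hε
  calc ∑ k, g k ^ 2 = ∑ k : Fin m, g' k ^ 2 := by simp [g']
    _ = ∑ k ∈ Finset.range m, g' k ^ 2 := Fin.sum_univ_eq_sum_range (fun k => g' k ^ 2) m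
    _ = ∑ k ∈ Finset.range (2 * s), g' k ^ 2 := by
      refine Finset.sum_subset (Finset.range_mono hms) fun k _ hk => ?_
      simp [g', Finset.mem_range.not.mp hk]
    _ = _ := by rw [hpair, ← Fin.sum_univ_eq_sum_range]

theorem homogeneousSubmodule_eq_span_monomial_finsuppAntidiag {σ R : Type*} [CommSemiring R]
    [Fintype σ] [DecidableEq σ] (d : ℕ) :
    homogeneousSubmodule σ R d = Submodule.span R (Set.range
      fun m : (Finset.univ : Finset σ).finsuppAntidiag d => monomial (m : σ →₀ ℕ) (1 : R)) := by
  apply le_antisymm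
  · intro p hp
    rw [p.as_sum]
    refine Submodule.sum_mem _ fun m hm => ?_
    have hdeg : m.degree = d := by
      have := hp (mem_support_iff.mp hm)
      rwa [Finsupp.degree_eq_weight_one]
    rw [← mul_one (coeff m p), ← smul_eq_mul, ← smul_monomial]
    refine Submodule.smul_mem _ _ (Submodule.subset_span ⟨⟨m, ?_⟩, rfl⟩)
    rw [Finset.mem_finsuppAntidiag]
    exact ⟨by rw [← hdeg, Finsupp.degree_eq_sum], Finset.subset_univ _⟩
  · rw [Submodule.span_le]
    rintro _ ⟨⟨m, hm⟩, rfl⟩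
    rw [Finset.mem_finsuppAntidiag] at hm
    exact isHomogeneous_monomial 1 ((Finsupp.degree_eq_sum m).trans hm.1)

theorem stmt_7 (n d : ℕ) (hn : 1 ≤ n) (hd : 1 ≤ d)
    (F : MvPolynomial (Fin (n + 1)) ℂ) (hF : F.IsHomogeneous (2 * d)) :
    ∃ Fi Gi : Fin (((n + d).choose n - 1) / 2 + 1) → MvPolynomial (Fin (n + 1)) ℂ,
      (∀ i, (Fi i).IsHomogeneous d) ∧ (∀ i, (Gi i).IsHomogeneous d) ∧
      F = ∑ i, Fi i * Gi i := by
  let u (m : (Finset.univ : Finset (Fin (n + 1))).finsuppAntidiag d) :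
    MvPolynomial (Fin (n + 1)) ℂ := monomial m 1
  have hspan : homogeneousSubmodule (Fin (n + 1)) ℂ d = Submodule.span ℂ (Set.range u) :=
    homogeneousSubmodule_eq_span_monomial_finsuppAntidiag d
  have hmem : F ∈ Submodule.span ℂ (Set.range fun p : _ × _ => u p.1 * u p.2) := by
    have h : F ∈ homogeneousSubmodule (Fin (n + 1)) ℂ (2 * d) := hF
    rw [← homogeneousSubmodule_one_pow, two_mul, pow_add, homogeneousSubmodule_one_pow, hspan,
      Submodule.span_mul_span] at h
    refine Submodule.span_mono ?_ h
    rintro _ ⟨_, ⟨i, rfl⟩, _, ⟨j, rfl⟩, rfl⟩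
    exact ⟨(i, j), rfl⟩
  obtain ⟨a, rfl⟩ := (Submodule.mem_span_range_iff_exists_fun ℂ).mp hmem
  have : Invertible (2 : ℂ) := invertibleOfNonzero two_ne_zero
  obtain ⟨g, hg, hsum⟩ := exists_sum_sq_eq_quadratic_expression u a
  have hcard : Fintype.card ((Finset.univ : Finset (Fin (n + 1))).finsuppAntidiag d) =
      (n + d).choose n := by
    rw [Fintype.card_coe, Finset.card_finsuppAntidiag_nat_eq_choose, Finset.card_univ,
      Fintype.card_fin, Nat.add_right_comm, Nat.add_sub_cancel, Nat.choose_symm_add]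
  rw [hsum]
  refine exists_sum_mul_eq_sum_sq (homogeneousSubmodule (Fin (n + 1)) ℂ d) (ε := C Complex.I)
    (by rw [← C_pow, Complex.I_sq, C_neg, C_1]) (fun v hv => ?_) (by omega) g
    fun k => hspan ▸ hg k
  rw [← smul_eq_C_mul]
  exact Submodule.smul_mem _ _ hv
end
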